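/- arXiv:1011.1186 — 3 statements merged into one kernel-verified Lean document; each statement's English description precedes it below -/
import Mathlib

section
/- Let r > 0, set q = e^{−π√r}, and assume k_r ∈ (0,1) satisfies K(√(1 − k_r²)) = √r · K(k_r). Then ∑_{n=0}^{∞} qⁿ/(1 + q^{2n}) = K(k_r)/(2π) + 1/4. -/
/-- The complete elliptic integral of the first kind
`K(x) = ∫₀^{π/2} dt / √(1 - x² sin² t)`. -/
noncomputable def Kint (x : ℝ) : ℝ :=
  ∫ t in (0 : ℝ)..(Real.pi / 2), 1 / Real.sqrt (1 - x ^ 2 * Real.sin t ^ 2)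

open Filter Topology MeasureTheory Set

/-- `∑_{n∈ℤ} sech((n+t)x)`. -/
noncomputable def sechSum (t x : ℝ) : ℝ := ∑' n : ℤ, (Real.cosh ((n + t) * x))⁻¹

lemma inv_cosh_le (y : ℝ) : (Real.cosh y)⁻¹ ≤ 2 * Real.exp (-y) := by
  have h := Real.cosh_pos y
  rw [inv_le_iff_one_le_mul₀ h, Real.cosh_eq]
  have : Real.exp (-y) * Real.exp y = 1 := by rw [← Real.exp_add]; simp
  nlinarith [Real.exp_pos (-y)]

lemma inv_cosh_le' (y : ℝ) : (Real.cosh y)⁻¹ ≤ 2 * Real.exp y := by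
  simpa using inv_cosh_le (-y)

lemma inv_cosh_pos (y : ℝ) : 0 < (Real.cosh y)⁻¹ := inv_pos.2 (Real.cosh_pos y)

lemma summable_sech (t : ℝ) {x : ℝ} (hx : 0 < x) :
    Summable fun n : ℤ => (Real.cosh ((n + t) * x))⁻¹ := by
  have hg : Summable fun n : ℕ => (Real.exp (-x)) ^ n :=
    summable_geometric_of_lt_one (Real.exp_pos _).le (by simpa using hx)
  apply Summable.of_nat_of_neg
  · refine Summable.of_nonneg_of_le (fun n => (inv_cosh_pos _).le) (fun n => ?_)
      (hg.mul_left (2 * Real.exp (-(t * x))))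
    refine (inv_cosh_le _).trans (le_of_eq ?_)
    rw [← Real.exp_nat_mul, mul_assoc, ← Real.exp_add]
    congr 2; push_cast; ring
  · refine Summable.of_nonneg_of_le (fun n => (inv_cosh_pos _).le) (fun n => ?_)
      (hg.mul_left (2 * Real.exp (t * x)))
    refine (inv_cosh_le' _).trans (le_of_eq ?_)
    rw [← Real.exp_nat_mul, mul_assoc, ← Real.exp_add]
    congr 2; push_cast; ring

lemma sechSum_pos (t : ℝ) {x : ℝ} (hx : 0 < x) : 0 < sechSum t x :=
  (summable_sech t hx).tsum_pos (fun n => (inv_cosh_pos _).le) 0 (inv_cosh_pos _)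

lemma tsum_int_even_odd {f : ℤ → ℝ} (hf : Summable f) :
    ∑' n, f n = ∑' n, f (2 * n) + ∑' n, f (2 * n + 1) := by
  have h1 : Function.Injective (fun n : ℤ => 2 * n) := fun a b h => by simpa using h
  have h2 : Function.Injective (fun n : ℤ => 2 * n + 1) := fun a b h => by simpa using h
  have hc : IsCompl (Set.range (fun n : ℤ => 2 * n)) (Set.range (fun n : ℤ => 2 * n + 1)) := by
    constructor
    · rw [Set.disjoint_iff_inter_eq_empty, Set.eq_empty_iff_forall_notMem]
      rintro _ ⟨⟨i, rfl⟩, ⟨j, h⟩⟩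
      simp only at h
      omega
    · rw [codisjoint_iff_le_sup]
      intro n _
      rcases Int.even_or_odd' n with ⟨k, h | h⟩
      · left; exact ⟨k, h.symm⟩
      · right; exact ⟨k, h.symm⟩
  have := (h1.hasSum_range_iff.mpr (hf.comp_injective h1).hasSum).add_isCompl hc
    (h2.hasSum_range_iff.mpr (hf.comp_injective h2).hasSum)
  exact this.tsum_eq

lemma sechSum_split {x : ℝ} (hx : 0 < x) :
    sechSum 0 x = sechSum 0 (2 * x) + sechSum (1/2) (2 * x) := by
  unfold sechSum
  rw [tsum_int_even_odd (summable_sech 0 hx)]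
  congr 1 <;> refine tsum_congr fun n => ?_ <;> congr 2 <;> push_cast <;> ring

lemma sum_Icc_succ_ends (f : ℤ → ℝ) (N : ℕ) :
    ∑ j ∈ Finset.Icc (-((N + 1 : ℕ) : ℤ)) ((N + 1 : ℕ) : ℤ), f j =
      ∑ j ∈ Finset.Icc (-(N : ℤ)) N, f j + f (N + 1) + f (-(N + 1)) := by
  have : Finset.Icc (-((N + 1 : ℕ) : ℤ)) ((N + 1 : ℕ) : ℤ) =
      insert (-((N : ℤ) + 1)) (insert ((N : ℤ) + 1) (Finset.Icc (-(N : ℤ)) N)) := by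
    ext j; simp only [Finset.mem_Icc, Finset.mem_insert]; push_cast; omega
  rw [this, Finset.sum_insert, Finset.sum_insert]
  · ring
  · simp
  · simp only [Finset.mem_Icc, Finset.mem_insert]; omega

/-- symmetric partial sums of `tanh (w + j h)` -/
noncomputable def tanhS (h w : ℝ) (N : ℕ) : ℝ :=
  ∑ j ∈ Finset.Icc (-(N : ℤ)) N, Real.tanh (w + j * h)

lemma tanhS_neg (h w : ℝ) (N : ℕ) : tanhS h (-w) N = - tanhS h w N := by
  unfold tanhS
  induction N with
  | zero => simp
  | succ N ih =>
    rw [sum_Icc_succ_ends, sum_Icc_succ_ends, ih]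
    have h1 : -w + (((N : ℤ) + 1 : ℤ) : ℝ) * h = -(w + ((-((N : ℤ) + 1) : ℤ) : ℝ) * h) := by
      push_cast; ring
    have h2 : -w + ((-((N : ℤ) + 1) : ℤ) : ℝ) * h = -(w + (((N : ℤ) + 1 : ℤ) : ℝ) * h) := by
      push_cast; ring
    rw [h1, h2, Real.tanh_neg, Real.tanh_neg]; ring

lemma tanhS_shift (h w : ℝ) (N : ℕ) : tanhS h (w + h) N =
    tanhS h w N + Real.tanh (w + (N + 1) * h) - Real.tanh (w - N * h) := by
  unfold tanhS
  induction N with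
  | zero => simp
  | succ N ih =>
    rw [sum_Icc_succ_ends, sum_Icc_succ_ends, ih]
    have h1 : w + h + (((N : ℤ) + 1 : ℤ) : ℝ) * h = w + (((N + 1 : ℕ) : ℝ) + 1) * h := by
      push_cast; ring
    have h2 : w + h + ((-((N : ℤ) + 1) : ℤ) : ℝ) * h = w - N * h := by push_cast; ring
    have h3 : w + (((N : ℤ) + 1 : ℤ) : ℝ) * h = w + (N + 1) * h := by push_cast; ring
    have h4 : w + ((-((N : ℤ) + 1) : ℤ) : ℝ) * h = w - ((N + 1 : ℕ) : ℝ) * h := by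
      push_cast; ring
    rw [h1, h2, h3, h4]; ring

lemma tendsto_tanh : Tendsto Real.tanh atTop (𝓝 1) := by
  have h : Tendsto (fun y : ℝ => (1 - Real.exp (-(2 * y))) / (1 + Real.exp (-(2*y)))) atTop
      (𝓝 ((1 - 0) / (1 + 0))) := by
    have : Tendsto (fun y : ℝ => Real.exp (-(2 * y))) atTop (𝓝 0) :=
      Real.tendsto_exp_neg_atTop_nhds_zero.comp (tendsto_id.const_mul_atTop (by norm_num))
    exact (this.const_sub 1).div (this.const_add 1) (by norm_num)
  simp only [sub_zero, add_zero, div_one] at h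
  refine h.congr fun y => ?_
  rw [Real.tanh_eq_sinh_div_cosh, Real.sinh_eq, Real.cosh_eq]
  have e : Real.exp (-(2 * y)) = Real.exp (-y) * Real.exp (-y) := by
    rw [← Real.exp_add]; ring_nf
  have e2 : Real.exp (-y) * Real.exp y = 1 := by rw [← Real.exp_add]; simp
  have := Real.exp_pos y
  have := Real.exp_pos (-y)
  rw [e, div_eq_div_iff (by positivity) (by positivity)]
  linear_combination (2 * Real.exp (-y)/2) * (1 - 1) * e2 + (-Real.exp (-y)) * e2

lemma tanhS_tail {h : ℝ} (hh : 0 < h) (w : ℝ) : Tendsto (fun N : ℕ =>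
    Real.tanh (w + (N + 1) * h) - Real.tanh (w - N * h)) atTop (𝓝 2) := by
  have hN : Tendsto (fun N : ℕ => (N : ℝ) * h) atTop atTop :=
    tendsto_natCast_atTop_atTop.atTop_mul_const hh
  have h1 : Tendsto (fun N : ℕ => Real.tanh (w + (N + 1) * h)) atTop (𝓝 1) := by
    refine tendsto_tanh.comp ?_
    refine (tendsto_atTop_add_const_left _ (w + h) hN).congr fun N => by ring
  have h2 : Tendsto (fun N : ℕ => Real.tanh (-w + N * h)) atTop (𝓝 1) :=
    tendsto_tanh.comp (tendsto_atTop_add_const_left _ _ hN)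
  have := h1.add h2
  rw [show (1:ℝ) + 1 = 2 by norm_num] at this
  refine this.congr fun N => ?_
  rw [show -w + (N:ℝ) * h = -(w - N * h) by ring, Real.tanh_neg]; ring

lemma tanhS_tendsto {h : ℝ} (hh : 0 < h) (p : ℤ) :
    Tendsto (tanhS h ((p + 1/2) * h)) atTop (𝓝 (2 * p + 1)) := by
  induction p using Int.induction_on with
  | zero =>
    have := (tanhS_tail hh (-(h/2))).div_const 2
    simp only [Int.cast_zero, zero_add, mul_zero]
    norm_num at this
    refine this.congr fun N => ?_
    have h1 := tanhS_shift h (-(h/2)) N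
    rw [tanhS_neg, show -(h/2) + h = h / 2 by ring] at h1
    rw [show (1/2) * h = h / 2 by ring]
    linarith
  | succ i ih =>
    have := ih.add (tanhS_tail hh (((i : ℤ) + 1/2) * h))
    have e : (2 * (((i : ℤ) + 1 : ℤ) : ℝ) + 1) = 2 * ((i : ℤ) : ℝ) + 1 + 2 := by push_cast; ring
    rw [e]
    refine this.congr fun N => ?_
    have h1 := tanhS_shift h (((i : ℤ) + 1/2) * h) N
    rw [show (((((i : ℤ) + 1 : ℤ) : ℝ) + 1/2) * h) = ((i : ℤ) + 1/2) * h + h by push_cast; ring, h1]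
    ring
  | pred i ih =>
    set w : ℝ := (((-(i : ℤ) - 1 : ℤ) : ℝ) + 1/2) * h with hw
    have := ih.sub (tanhS_tail hh w)
    have e : (2 * ((-(i : ℤ) - 1 : ℤ) : ℝ) + 1) = 2 * ((-(i : ℤ) : ℤ) : ℝ) + 1 - 2 := by
      push_cast; ring
    rw [e]
    refine this.congr fun N => ?_
    have h1 := tanhS_shift h w N
    rw [show (((-(i : ℤ) : ℤ) : ℝ) + 1/2) * h = w + h by rw [hw]; push_cast; ring, h1]
    ring

lemma tanh_add_tanh (A B : ℝ) :
    Real.tanh A + Real.tanh B = Real.sinh (A + B) * ((Real.cosh A)⁻¹ * (Real.cosh B)⁻¹) := by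
  have := Real.cosh_pos A
  have := Real.cosh_pos B
  rw [Real.tanh_eq_sinh_div_cosh, Real.tanh_eq_sinh_div_cosh, Real.sinh_add]
  field_simp

lemma tsum_of_symm {f : ℤ → ℝ} (hf : Summable f) {L : ℝ}
    (h : Tendsto (fun N : ℕ => ∑ j ∈ Finset.Icc (-(N : ℤ)) N, f j) atTop (𝓝 L)) :
    ∑' j, f j = L :=
  tendsto_nhds_unique (hf.hasSum.comp Finset.tendsto_Icc_neg) h

lemma sinh_odd_ne {x : ℝ} (hx : 0 < x) (p : ℤ) : Real.sinh ((2 * p + 1) * x) ≠ 0 := by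
  rw [Ne, Real.sinh_eq_zero, mul_eq_zero]
  rintro (h | h)
  · have : (2 * p + 1 : ℤ) = 0 := by exact_mod_cast h
    omega
  · exact hx.ne' h

lemma inner1 {x : ℝ} (hx : 0 < x) (p : ℤ)
    (hs : Summable fun j : ℤ => (Real.cosh (((p + j : ℤ) + 1/2) * x))⁻¹ *
      (Real.cosh (((p - j : ℤ) + 1/2) * x))⁻¹) :
    ∑' j : ℤ, (Real.cosh (((p + j : ℤ) + 1/2) * x))⁻¹ *
      (Real.cosh (((p - j : ℤ) + 1/2) * x))⁻¹ =
      2 * ((2 * p + 1) / Real.sinh ((2 * p + 1) * x)) := by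
  have hne := sinh_odd_ne hx p
  apply tsum_of_symm hs
  have h1 := ((tanhS_tendsto hx p).sub (tanhS_tendsto hx (-p - 1))).div_const
    (Real.sinh ((2 * p + 1) * x))
  have e : ((2 * p + 1 : ℝ) - (2 * ((-p - 1 : ℤ) : ℝ) + 1)) / Real.sinh ((2 * p + 1) * x) =
      2 * ((2 * p + 1) / Real.sinh ((2 * p + 1) * x)) := by push_cast; ring
  rw [e] at h1
  refine h1.congr fun N => ?_
  unfold tanhS
  rw [← Finset.sum_sub_distrib, Finset.sum_div]
  refine Finset.sum_congr rfl fun j _ => ?_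
  rw [div_eq_iff hne, mul_comm _ (Real.sinh _)]
  rw [show (2 * (p:ℝ) + 1) * x = ((p + j : ℤ) + 1/2) * x + ((p - j : ℤ) + 1/2) * x by
    push_cast; ring, ← tanh_add_tanh, sub_eq_add_neg, ← Real.tanh_neg]
  congr 2 <;> push_cast <;> ring

lemma inner2 {x : ℝ} (hx : 0 < x) (p : ℤ)
    (hs : Summable fun j : ℤ => (Real.cosh ((j + 0) * (2 * x)))⁻¹ *
      (Real.cosh (((p - j : ℤ) + 1/2) * (2 * x)))⁻¹) :
    ∑' j : ℤ, (Real.cosh ((j + 0) * (2 * x)))⁻¹ *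
      (Real.cosh (((p - j : ℤ) + 1/2) * (2 * x)))⁻¹ =
      (2 * p + 1) / Real.sinh ((2 * p + 1) * x) := by
  have hne := sinh_odd_ne hx p
  have hx2 : 0 < 2 * x := by positivity
  apply tsum_of_symm hs
  have h1 := ((tanhS_tendsto hx2 (-p - 1)).neg).div_const
    (Real.sinh ((2 * p + 1) * x))
  have e : (-(2 * ((-p - 1 : ℤ) : ℝ) + 1)) / Real.sinh ((2 * p + 1) * x) =
      ((2 * p + 1) / Real.sinh ((2 * p + 1) * x)) := by push_cast; ring
  rw [e] at h1
  refine h1.congr fun N => ?_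
  have h0 : tanhS (2 * x) 0 N = 0 := by
    have := tanhS_neg (2 * x) 0 N
    rw [neg_zero] at this; linarith
  have h3 : -tanhS (2 * x) (((-p - 1 : ℤ) + 1 / 2) * (2 * x)) N =
      tanhS (2 * x) 0 N - tanhS (2 * x) (((-p - 1 : ℤ) + 1 / 2) * (2 * x)) N := by
    rw [h0, zero_sub]
  rw [h3]
  unfold tanhS
  rw [← Finset.sum_sub_distrib, Finset.sum_div]
  refine Finset.sum_congr rfl fun j _ => ?_
  rw [div_eq_iff hne, mul_comm _ (Real.sinh _)]
  rw [show (2 * (p:ℝ) + 1) * x = (j + 0) * (2 * x) + ((p - j : ℤ) + 1/2) * (2 * x) by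
    push_cast; ring, ← tanh_add_tanh, sub_eq_add_neg, ← Real.tanh_neg]
  congr 2 <;> push_cast <;> ring

lemma summable_prod_sech (t u : ℝ) {x : ℝ} (hx : 0 < x) :
    Summable fun z : ℤ × ℤ => (Real.cosh ((z.1 + t) * x))⁻¹ * (Real.cosh ((z.2 + u) * x))⁻¹ :=
  (summable_sech t hx).mul_of_nonneg (summable_sech u hx) (fun n => (inv_cosh_pos _).le)
    (fun n => (inv_cosh_pos _).le)

lemma sechSum_mul (t u : ℝ) {x : ℝ} (hx : 0 < x) : sechSum t x * sechSum u x =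
    ∑' z : ℤ × ℤ, (Real.cosh ((z.1 + t) * x))⁻¹ * (Real.cosh ((z.2 + u) * x))⁻¹ :=
  (summable_sech t hx).tsum_mul_tsum (summable_sech u hx) (summable_prod_sech t u hx)

/-- shear of `ℤ × ℤ` -/
def shearEquiv : ℤ × ℤ ≃ ℤ × ℤ where
  toFun z := (z.2, z.1 - z.2)
  invFun z := (z.1 + z.2, z.1)
  left_inv z := by ext <;> simp
  right_inv z := by ext <;> simp

/-- parity splitting of `ℤ × ℤ` -/
def parityFun : (ℤ × ℤ) ⊕ (ℤ × ℤ) → ℤ × ℤ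
  | Sum.inl z => (z.1 + z.2, z.1 - z.2)
  | Sum.inr z => (z.1 + z.2, z.2 - z.1 - 1)

lemma parityFun_bij : Function.Bijective parityFun := by
  constructor
  · rintro (⟨a, b⟩ | ⟨a, b⟩) (⟨c, d⟩ | ⟨c, d⟩) h <;>
      simp only [parityFun, Prod.mk.injEq] at h <;> obtain ⟨h1, h2⟩ := h
    · congr 2 <;> omega
    · omega
    · omega
    · congr 2 <;> omega
  · rintro ⟨m, n⟩
    rcases Int.even_or_odd' (m + n) with ⟨k, h | h⟩
    · exact ⟨Sum.inl (k, m - k), by simp only [parityFun, Prod.mk.injEq]; omega⟩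
    · exact ⟨Sum.inr (m - k - 1, k + 1), by simp only [parityFun, Prod.mk.injEq]; omega⟩

lemma summable_parity_left {F : ℤ × ℤ → ℝ} (hF : Summable F) :
    Summable (fun z : ℤ × ℤ => F (z.1 + z.2, z.1 - z.2)) :=
  (hF.comp_injective parityFun_bij.1).comp_injective Sum.inl_injective

lemma summable_parity_right {F : ℤ × ℤ → ℝ} (hF : Summable F) :
    Summable (fun z : ℤ × ℤ => F (z.1 + z.2, z.2 - z.1 - 1)) :=
  (hF.comp_injective parityFun_bij.1).comp_injective Sum.inr_injective

lemma tsum_parity_aux (F : ℤ × ℤ → ℝ) : ∑' z, F (parityFun z) = ∑' z, F z :=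
  (Equiv.ofBijective parityFun parityFun_bij).tsum_eq F

lemma tsum_parity {F : ℤ × ℤ → ℝ} (hF : Summable F) :
    ∑' z, F z = (∑' z : ℤ × ℤ, F (z.1 + z.2, z.1 - z.2)) +
      ∑' z : ℤ × ℤ, F (z.1 + z.2, z.2 - z.1 - 1) := by
  rw [← tsum_parity_aux F]
  exact Summable.tsum_sum (f := F ∘ parityFun) (summable_parity_left hF) (summable_parity_right hF)

lemma sechSum_key_right {x : ℝ} (hx : 0 < x) :
    sechSum 0 (2 * x) * sechSum (1/2) (2 * x) =
      ∑' p : ℤ, (2 * p + 1) / Real.sinh ((2 * p + 1) * x) := by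
  have hx2 : 0 < 2 * x := by positivity
  rw [sechSum_mul 0 (1/2) hx2, ← shearEquiv.tsum_eq]
  have hs := (shearEquiv.summable_iff).2 (summable_prod_sech 0 (1/2) hx2)
  refine hs.tsum_prod.trans ?_
  refine tsum_congr fun p => ?_
  exact inner2 hx p (hs.prod_factor p)

lemma sechSum_key_left {x : ℝ} (hx : 0 < x) :
    sechSum (1/2) x ^ 2 =
      2 * ∑' p : ℤ, 2 * ((2 * p + 1) / Real.sinh ((2 * p + 1) * x)) := by
  have hl := summable_parity_left (summable_prod_sech (1/2) (1/2) hx)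
  have h := tsum_parity (summable_prod_sech (1/2) (1/2) hx)
  rw [sq, sechSum_mul (1/2) (1/2) hx, h]
  have hr : ∀ z : ℤ × ℤ, (Real.cosh (((z.2 - z.1 - 1 : ℤ) + 1/2) * x))⁻¹ =
      (Real.cosh (((z.1 - z.2 : ℤ) + 1/2) * x))⁻¹ := by
    intro z
    rw [← Real.cosh_neg]
    congr 2; push_cast; ring
  simp only [hr]
  rw [← two_mul]
  congr 1
  refine hl.tsum_prod.trans ?_
  refine tsum_congr fun p => ?_
  exact inner1 hx p (hl.prod_factor p)

lemma sechSum_key {x : ℝ} (hx : 0 < x) :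
    sechSum (1/2) x ^ 2 = 4 * (sechSum 0 (2 * x) * sechSum (1/2) (2 * x)) := by
  rw [sechSum_key_left hx, sechSum_key_right hx, tsum_mul_left]; ring

/-- Gauss's integral. -/
noncomputable def gaussI (a b : ℝ) : ℝ :=
  ∫ t in (0 : ℝ)..(Real.pi / 2), 1 / Real.sqrt (a ^ 2 * Real.cos t ^ 2 + b ^ 2 * Real.sin t ^ 2)

lemma Kint_eq (k k' : ℝ) (h : k ^ 2 + k' ^ 2 = 1) : Kint k = gaussI 1 k' := by
  unfold Kint gaussI
  congr 1; funext t
  congr 2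
  have := Real.sin_sq_add_cos_sq t
  linear_combination -this - Real.sin t ^ 2 * h

lemma gaussI_scale (c a b : ℝ) (hc : 0 < c) : gaussI (c * a) (c * b) = gaussI a b / c := by
  unfold gaussI
  rw [← intervalIntegral.integral_div]
  congr 1; funext t
  rw [show (c * a) ^ 2 * Real.cos t ^ 2 + (c * b) ^ 2 * Real.sin t ^ 2 =
    c ^ 2 * (a ^ 2 * Real.cos t ^ 2 + b ^ 2 * Real.sin t ^ 2) by ring,
    Real.sqrt_mul (by positivity), Real.sqrt_sq hc.le, div_div, mul_comm c]

lemma gauss_arg_pos {a b : ℝ} (ha : 0 < a) (hb : 0 < b) (t : ℝ) :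
    0 < a ^ 2 * Real.cos t ^ 2 + b ^ 2 * Real.sin t ^ 2 := by
  have h := Real.sin_sq_add_cos_sq t
  rcases eq_or_ne (Real.sin t) 0 with h0 | h0
  · rw [h0] at h ⊢
    have : Real.cos t ^ 2 = 1 := by linarith
    rw [this]; positivity
  · positivity

lemma gauss_cont {a b : ℝ} (ha : 0 < a) (hb : 0 < b) :
    Continuous fun t => 1 / Real.sqrt (a ^ 2 * Real.cos t ^ 2 + b ^ 2 * Real.sin t ^ 2) := by
  refine continuous_const.div (by fun_prop) fun t => ?_
  exact (Real.sqrt_pos.2 (gauss_arg_pos ha hb t)).ne'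

lemma gaussI_anti {a b a' b' : ℝ} (ha : 0 < a) (hb : 0 < b) (haa : a ≤ a') (hbb : b ≤ b') :
    gaussI a' b' ≤ gaussI a b := by
  unfold gaussI
  apply intervalIntegral.integral_mono_on (by positivity)
    ((gauss_cont (ha.trans_le haa) (hb.trans_le hbb)).intervalIntegrable _ _)
    ((gauss_cont ha hb).intervalIntegrable _ _)
  intro t _
  apply one_div_le_one_div_of_le (Real.sqrt_pos.2 (gauss_arg_pos ha hb t))
  apply Real.sqrt_le_sqrt
  gcongr

lemma gaussI_self {a : ℝ} (ha : 0 < a) : gaussI a a = Real.pi / 2 / a := by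
  unfold gaussI
  have : ∀ t, 1 / Real.sqrt (a ^ 2 * Real.cos t ^ 2 + a ^ 2 * Real.sin t ^ 2) = 1 / a := by
    intro t
    rw [← mul_add, Real.cos_sq_add_sin_sq, mul_one, Real.sqrt_sq ha.le]
  simp only [this]
  rw [intervalIntegral.integral_const]
  simp [div_eq_mul_inv]

/-- algebraic integrand -/
noncomputable def gaussF (a b t : ℝ) : ℝ := 1 / Real.sqrt ((t ^ 2 + a ^ 2) * (t ^ 2 + b ^ 2))

lemma gaussI_eq_Ioi {a b : ℝ} (ha : 0 < a) (hb : 0 < b) :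
    gaussI a b = ∫ t in Ioi (0 : ℝ), gaussF a b t := by
  have himg : (fun t => b * Real.tan t) '' Ioo 0 (Real.pi / 2) = Ioi 0 := by
    ext y
    simp only [mem_image, mem_Ioo, mem_Ioi]
    constructor
    · rintro ⟨t, ⟨h0, h1⟩, rfl⟩
      exact mul_pos hb (Real.tan_pos_of_pos_of_lt_pi_div_two h0 h1)
    · intro hy
      refine ⟨Real.arctan (y / b), ⟨?_, Real.arctan_lt_pi_div_two _⟩, ?_⟩
      · rw [Real.arctan_pos]; positivity
      · rw [Real.tan_arctan]; field_simp
  have hcos : ∀ t ∈ Ioo 0 (Real.pi / 2), 0 < Real.cos t := fun t ht =>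
    Real.cos_pos_of_mem_Ioo ⟨by linarith [ht.1, Real.pi_pos], ht.2⟩
  have hinj : InjOn (fun t => b * Real.tan t) (Ioo 0 (Real.pi / 2)) := by
    intro s hs t ht h
    have h' : Real.tan s = Real.tan t := mul_left_cancel₀ hb.ne' h
    exact Real.tan_inj_of_lt_of_lt_pi_div_two (by linarith [hs.1, Real.pi_pos]) hs.2
      (by linarith [ht.1, Real.pi_pos]) ht.2 h'
  rw [← himg, integral_image_eq_integral_abs_deriv_smul measurableSet_Ioo
    (f' := fun t => b * (1 / Real.cos t ^ 2)) (fun t ht =>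
      ((Real.hasDerivAt_tan (hcos t ht).ne').const_mul b).hasDerivWithinAt) hinj]
  unfold gaussI
  rw [intervalIntegral.integral_of_le (by positivity), integral_Ioc_eq_integral_Ioo]
  refine setIntegral_congr_fun measurableSet_Ioo fun t ht => ?_
  have hc := hcos t ht
  have hp := gauss_arg_pos ha hb t
  simp only [gaussF, smul_eq_mul]
  rw [abs_of_pos (by positivity)]
  have e : ((b * Real.tan t) ^ 2 + a ^ 2) * ((b * Real.tan t) ^ 2 + b ^ 2) =
      (b / Real.cos t ^ 2) ^ 2 * (a ^ 2 * Real.cos t ^ 2 + b ^ 2 * Real.sin t ^ 2) := by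
    rw [Real.tan_eq_sin_div_cos]
    field_simp
    linear_combination (a ^ 2 * Real.cos t ^ 2 + b ^ 2 * Real.sin t ^ 2) * Real.sin_sq_add_cos_sq t
  rw [e, Real.sqrt_mul (by positivity), Real.sqrt_sq (by positivity)]
  have := Real.sqrt_pos.2 hp
  field_simp

lemma gaussI_step {a b g : ℝ} (ha : 0 < a) (hb : 0 < b) (hg : 0 < g) (hgab : g ^ 2 = a * b) :
    gaussI ((a + b) / 2) g = gaussI a b := by
  rw [gaussI_eq_Ioi (by positivity) hg, gaussI_eq_Ioi ha hb]
  have h2 := integral_comp_abs (f := gaussF ((a + b) / 2) g)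
  have h3 : (fun x => gaussF ((a + b) / 2) g |x|) = gaussF ((a + b) / 2) g := by
    funext x; simp [gaussF, sq_abs]
  rw [h3] at h2
  have himg : (fun t => (t - g ^ 2 / t) / 2) '' Ioi 0 = univ := by
    rw [eq_univ_iff_forall]
    intro y
    have hpos : 0 < y + Real.sqrt (y ^ 2 + g ^ 2) := by
      have h1 : |y| < Real.sqrt (y ^ 2 + g ^ 2) := by
        rw [← Real.sqrt_sq_eq_abs]
        exact Real.sqrt_lt_sqrt (sq_nonneg _) (by nlinarith)
      linarith [neg_abs_le y]
    refine ⟨y + Real.sqrt (y ^ 2 + g ^ 2), hpos, ?_⟩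
    have := Real.sq_sqrt (show 0 ≤ y ^ 2 + g ^ 2 by positivity)
    simp only
    field_simp
    linear_combination this
  have hinj : InjOn (fun t => (t - g ^ 2 / t) / 2) (Ioi 0) := by
    intro s hs t ht h
    simp only [mem_Ioi] at hs ht h
    field_simp at h
    have : (s - t) * (s * t + g ^ 2) = 0 := by linear_combination h
    rcases mul_eq_zero.1 this with h | h
    · linarith
    · have : 0 < s * t + g ^ 2 := by positivity
      linarith
  have h4 := integral_image_eq_integral_abs_deriv_smul (s := Ioi (0:ℝ)) measurableSet_Ioi
    (f := fun t => (t - g ^ 2 / t) / 2)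
    (f' := fun t => (1 + g ^ 2 / t ^ 2) / 2) (fun t ht => by
      have ht' : t ≠ 0 := (mem_Ioi.1 ht).ne'
      have := (((hasDerivAt_id t).sub ((hasDerivAt_inv ht').const_mul (g ^ 2))).div_const 2)
      refine HasDerivAt.hasDerivWithinAt ?_
      have hd : (1 + g ^ 2 / t ^ 2) / 2 = (1 - g ^ 2 * (-(t ^ 2)⁻¹)) / 2 := by ring
      rw [hd]
      refine this.congr_of_eventuallyEq (Eventually.of_forall fun s => ?_)
      simp [div_eq_mul_inv]) hinj (gaussF ((a + b) / 2) g)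
  rw [himg, setIntegral_univ] at h4
  have h5 : ∫ t in Ioi (0 : ℝ), |(1 + g ^ 2 / t ^ 2) / 2| • gaussF ((a + b) / 2) g
      ((t - g ^ 2 / t) / 2) = ∫ t in Ioi (0 : ℝ), 2 * gaussF a b t := by
    refine setIntegral_congr_fun measurableSet_Ioi fun t ht => ?_
    have ht' : 0 < t := ht
    simp only [gaussF, smul_eq_mul]
    rw [abs_of_pos (by positivity)]
    have e : (((t - g ^ 2 / t) / 2) ^ 2 + ((a + b) / 2) ^ 2) *
        (((t - g ^ 2 / t) / 2) ^ 2 + g ^ 2) =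
        ((t ^ 2 + g ^ 2) / (4 * t ^ 2)) ^ 2 * ((t ^ 2 + a ^ 2) * (t ^ 2 + b ^ 2)) := by
      rw [hgab]
      field_simp
      ring
    rw [e, Real.sqrt_mul (by positivity), Real.sqrt_sq (by positivity)]
    have : 0 < Real.sqrt ((t ^ 2 + a ^ 2) * (t ^ 2 + b ^ 2)) := by positivity
    field_simp
    ring
  rw [h5, integral_const_mul] at h4
  linarith

lemma gaussI_agm {A B : ℕ → ℝ} {L : ℝ} (hA : ∀ n, 0 < A n) (hB : ∀ n, 0 < B n) (hL : 0 < L)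
    (h1 : ∀ n, A (n + 1) = (A n + B n) / 2) (h2 : ∀ n, B (n + 1) ^ 2 = A n * B n)
    (hlim : Tendsto A atTop (𝓝 L)) : gaussI (A 0) (B 0) = Real.pi / 2 / L := by
  have hconst : ∀ n, gaussI (A n) (B n) = gaussI (A 0) (B 0) := by
    intro n
    induction n with
    | zero => rfl
    | succ n ih => rw [h1, gaussI_step (hA n) (hB n) (hB (n+1)) (h2 n), ih]
  have hBlim : Tendsto B atTop (𝓝 L) := by
    have := ((hlim.comp (tendsto_add_atTop_nat 1)).const_mul 2).sub hlim
    rw [show 2 * L - L = L by ring] at this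
    refine this.congr fun n => ?_
    simp only [Function.comp, h1]; ring
  have hlo : Tendsto (fun n => Real.pi / 2 / max (A n) (B n)) atTop (𝓝 (Real.pi / 2 / L)) := by
    have := hlim.max hBlim
    rw [max_self] at this
    exact tendsto_const_nhds.div this hL.ne'
  have hhi : Tendsto (fun n => Real.pi / 2 / min (A n) (B n)) atTop (𝓝 (Real.pi / 2 / L)) := by
    have := hlim.min hBlim
    rw [min_self] at this
    exact tendsto_const_nhds.div this hL.ne'
  apply le_antisymm
  · refine ge_of_tendsto' hhi fun n => ?_
    have hm : 0 < min (A n) (B n) := lt_min (hA n) (hB n)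
    rw [← hconst n, ← gaussI_self hm]
    exact gaussI_anti hm hm (min_le_left _ _) (min_le_right _ _)
  · refine le_of_tendsto' hlo fun n => ?_
    have hm : 0 < max (A n) (B n) := lt_max_of_lt_left (hA n)
    rw [← hconst n, ← gaussI_self hm]
    exact gaussI_anti (hA n) (hB n) (le_max_left _ _) (le_max_right _ _)

lemma tendsto_sechSum_one {x : ℝ} (hx : 0 < x) :
    Tendsto (fun n : ℕ => sechSum 0 (2 ^ n * x)) atTop (𝓝 1) := by
  have h : Tendsto (fun n : ℕ => ∑' j : ℤ, (Real.cosh ((j + 0) * (2 ^ n * x)))⁻¹) atTop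
      (𝓝 (∑' j : ℤ, if j = 0 then (1 : ℝ) else 0)) := by
    refine tendsto_tsum_of_dominated_convergence (summable_sech 0 hx) (fun j => ?_)
      (Eventually.of_forall fun n j => ?_)
    · by_cases hj : j = 0
      · subst hj; simp
      · simp only [hj, if_false]
        have hj' : (0:ℝ) < |(j:ℝ)| := abs_pos.2 (by exact_mod_cast hj)
        have hp : Tendsto (fun n : ℕ => (2:ℝ) ^ n * (|(j:ℝ)| * x)) atTop atTop :=
          (tendsto_pow_atTop_atTop_of_one_lt (by norm_num)).atTop_mul_const (by positivity)
        have h0 : Tendsto (fun n : ℕ => 2 * Real.exp (-((2:ℝ) ^ n * (|(j:ℝ)| * x)))) atTop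
            (𝓝 (2 * 0)) :=
          (Real.tendsto_exp_neg_atTop_nhds_zero.comp hp).const_mul 2
        rw [mul_zero] at h0
        refine squeeze_zero (fun n => (inv_cosh_pos _).le) (fun n => ?_) h0
        have : Real.cosh (((j:ℝ) + 0) * (2 ^ n * x)) = Real.cosh (2 ^ n * (|(j:ℝ)| * x)) := by
          rw [← Real.cosh_abs]
          congr 1
          rw [add_zero, abs_mul, abs_of_pos (show (0:ℝ) < 2 ^ n * x by positivity)]; ring
        rw [this]
        exact inv_cosh_le _
    · rw [Real.norm_of_nonneg (inv_cosh_pos _).le]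
      apply inv_anti₀ (Real.cosh_pos _)
      rw [Real.cosh_le_cosh, abs_mul, abs_mul]
      apply mul_le_mul_of_nonneg_left _ (abs_nonneg _)
      rw [abs_of_pos hx, abs_of_pos (by positivity)]
      have : (1:ℝ) ≤ 2 ^ n := one_le_pow₀ (by norm_num)
      nlinarith
  rw [tsum_ite_eq] at h
  exact h

lemma summable_sech_nat {x : ℝ} (hx : 0 < x) :
    Summable fun n : ℕ => (Real.cosh (n * x))⁻¹ := by
  have := (summable_sech 0 hx).comp_injective (Nat.cast_injective (R := ℤ))
  simpa [Function.comp_def] using this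

lemma sechSum_nat {x : ℝ} (hx : 0 < x) :
    sechSum 0 x = 2 * ∑' n : ℕ, (Real.cosh (n * x))⁻¹ - 1 := by
  have h := tsum_nat_add_neg (summable_sech 0 hx)
  simp only [Int.cast_natCast, Int.cast_neg, add_zero, neg_mul, Real.cosh_neg, Int.cast_zero,
    zero_mul, Real.cosh_zero, inv_one] at h
  simp only [← two_mul, tsum_mul_left] at h
  unfold sechSum
  simp only [add_zero]
  linarith

/-- antiderivative of `sech` -/
noncomputable def gdF (y : ℝ) : ℝ := 2 * Real.arctan (Real.exp y)

lemma hasDerivAt_gdF (y : ℝ) : HasDerivAt gdF (Real.cosh y)⁻¹ y := by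
  have h := ((Real.hasDerivAt_exp y).arctan).const_mul 2
  have e : (Real.cosh y)⁻¹ = 2 * (1 / (1 + Real.exp y ^ 2) * Real.exp y) := by
    rw [Real.cosh_eq, Real.exp_neg]
    have := Real.exp_pos y
    field_simp
    ring
  rw [e]; exact h

lemma gdF_bounds {u v : ℝ} (hu : 0 ≤ u) (huv : u < v) :
    (v - u) * (Real.cosh v)⁻¹ ≤ gdF v - gdF u ∧ gdF v - gdF u ≤ (v - u) * (Real.cosh u)⁻¹ := by
  obtain ⟨c, hc, h⟩ := exists_hasDerivAt_eq_slope gdF (fun y => (Real.cosh y)⁻¹) huv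
    (fun y _ => (hasDerivAt_gdF y).continuousAt.continuousWithinAt)
    (fun y _ => hasDerivAt_gdF y)
  have hvu : 0 < v - u := sub_pos.2 huv
  have h' : gdF v - gdF u = (v - u) * (Real.cosh c)⁻¹ := by rw [h]; field_simp
  have hc0 : 0 < c := hu.trans_lt hc.1
  rw [h']
  constructor
  · refine mul_le_mul_of_nonneg_left (inv_anti₀ (Real.cosh_pos _) ?_) hvu.le
    rw [Real.cosh_le_cosh, abs_of_pos hc0, abs_of_pos (hc0.trans hc.2)]; exact hc.2.le
  · refine mul_le_mul_of_nonneg_left (inv_anti₀ (Real.cosh_pos _) ?_) hvu.le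
    rw [Real.cosh_le_cosh, abs_of_pos hc0, abs_of_nonneg hu]; exact hc.1.le

lemma tendsto_gdF : Tendsto gdF atTop (𝓝 Real.pi) := by
  have h : Tendsto Real.arctan atTop (𝓝 (Real.pi / 2)) :=
    tendsto_nhds_of_tendsto_nhdsWithin Real.tendsto_arctan_atTop
  have := (h.comp Real.tendsto_exp_atTop).const_mul 2
  rw [show 2 * (Real.pi / 2) = Real.pi by ring] at this
  exact this

lemma sech_riemann {x : ℝ} (hx : 0 < x) :
    Real.pi - x ≤ x * sechSum 0 x ∧ x * sechSum 0 x ≤ Real.pi + x := by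
  have hs := summable_sech_nat hx
  have hN : Tendsto (fun N : ℕ => (N : ℝ) * x) atTop atTop :=
    tendsto_natCast_atTop_atTop.atTop_mul_const hx
  have h0 : gdF 0 = Real.pi / 2 := by simp [gdF]; ring
  have hlim : Tendsto (fun N : ℕ => gdF (N * x) - gdF 0) atTop (𝓝 (Real.pi / 2)) := by
    have := (tendsto_gdF.comp hN).sub_const (gdF 0)
    rw [show Real.pi - gdF 0 = Real.pi / 2 by rw [h0]; ring] at this
    exact this
  have hb : ∀ N : ℕ, x * (Real.cosh ((N + 1 : ℕ) * x))⁻¹ ≤ gdF ((N + 1 : ℕ) * x) - gdF (N * x) ∧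
      gdF ((N + 1 : ℕ) * x) - gdF (N * x) ≤ x * (Real.cosh (N * x))⁻¹ := by
    intro N
    have := gdF_bounds (u := N * x) (v := (N + 1 : ℕ) * x) (by positivity) (by push_cast; nlinarith)
    rw [show ((N + 1 : ℕ) : ℝ) * x - N * x = x by push_cast; ring] at this
    exact this
  have htel : ∀ N : ℕ, ∑ n ∈ Finset.range N, (gdF ((n + 1 : ℕ) * x) - gdF (n * x)) =
      gdF (N * x) - gdF 0 := by
    intro N
    rw [Finset.sum_range_sub (fun n : ℕ => gdF (n * x))]; simp
  set S := ∑' n : ℕ, (Real.cosh (n * x))⁻¹ with hS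
  have hup : Real.pi / 2 ≤ x * S := by
    refine le_of_tendsto_of_tendsto' hlim (hs.hasSum.tendsto_sum_nat.const_mul x) fun N => ?_
    rw [← htel, Finset.mul_sum]
    exact Finset.sum_le_sum fun n _ => (hb n).2
  have hs1 : HasSum (fun n : ℕ => (Real.cosh ((n + 1 : ℕ) * x))⁻¹) (S - 1) := by
    have := (hasSum_nat_add_iff' (f := fun n : ℕ => (Real.cosh (n * x))⁻¹) 1).2 hs.hasSum
    simpa using this
  have hlo : x * (S - 1) ≤ Real.pi / 2 := by
    refine le_of_tendsto_of_tendsto' (hs1.tendsto_sum_nat.const_mul x) hlim fun N => ?_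
    rw [← htel, Finset.mul_sum]
    exact Finset.sum_le_sum fun n _ => (hb n).1
  rw [sechSum_nat hx, ← hS]
  constructor <;> linarith

lemma tendsto_sechSum_zero {x : ℝ} (hx : 0 < x) :
    Tendsto (fun n : ℕ => sechSum 0 (x / 2 ^ n) / 2 ^ n) atTop (𝓝 (Real.pi / x)) := by
  have hz : Tendsto (fun n : ℕ => x / 2 ^ n) atTop (𝓝 0) :=
    tendsto_const_nhds.div_atTop (tendsto_pow_atTop_atTop_of_one_lt (by norm_num))
  have h1 : Tendsto (fun n : ℕ => (Real.pi - x / 2 ^ n) / x) atTop (𝓝 (Real.pi / x)) := by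
    have := (hz.const_sub Real.pi).div_const x
    rwa [sub_zero] at this
  have h2 : Tendsto (fun n : ℕ => (Real.pi + x / 2 ^ n) / x) atTop (𝓝 (Real.pi / x)) := by
    have := (hz.const_add Real.pi).div_const x
    rwa [add_zero] at this
  refine tendsto_of_tendsto_of_tendsto_of_le_of_le h1 h2 (fun n => ?_) (fun n => ?_)
  · have := (sech_riemann (show 0 < x / 2 ^ n by positivity)).1
    simp only
    rw [div_le_iff₀ hx]
    refine this.trans (le_of_eq (by ring))
  · have := (sech_riemann (show 0 < x / 2 ^ n by positivity)).2
    simp only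
    rw [le_div_iff₀ hx]
    refine le_trans (le_of_eq (by ring)) this

/-- alternating sum -/
noncomputable def sechAlt (x : ℝ) : ℝ := sechSum 0 (2 * x) - sechSum (1/2) (2 * x)

lemma sechAlt_sq {x : ℝ} (hx : 0 < x) :
    sechSum 0 x ^ 2 = sechAlt x ^ 2 + sechSum (1/2) x ^ 2 := by
  rw [sechSum_key hx, sechSum_split hx, sechAlt]; ring

lemma sechAlt_mean {x : ℝ} (hx : 0 < x) :
    sechSum 0 (2 * x) = (sechSum 0 x + sechAlt x) / 2 := by
  rw [sechSum_split hx, sechAlt]; ring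

lemma sechAlt_geom {x : ℝ} (hx : 0 < x) :
    sechAlt (2 * x) ^ 2 = sechSum 0 x * sechAlt x := by
  have := sechAlt_sq (show 0 < 2 * x by positivity)
  have e : sechAlt (2 * x) ^ 2 = sechSum 0 (2 * x) ^ 2 - sechSum (1/2) (2 * x) ^ 2 := by linarith
  rw [e, sechSum_split hx, sechAlt]; ring

lemma sechAlt_pos {x : ℝ} (hx : 0 < x) : 0 < sechAlt x := by
  have hstep : ∀ y : ℝ, 0 < y → ¬ 0 < sechAlt y → ¬ 0 < sechAlt (2 * y) := by
    intro y hy h1 h2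
    have h3 := sechAlt_geom hy
    have h4 := sechSum_pos 0 hy
    have h5 : 0 < sechAlt (2 * y) ^ 2 := by positivity
    rw [h3] at h5
    exact h1 ((mul_pos_iff_of_pos_left h4).1 h5)
  by_contra hneg
  have hall : ∀ n : ℕ, ¬ 0 < sechAlt (2 ^ n * x) := by
    intro n
    induction n with
    | zero => simpa using hneg
    | succ n ih =>
      have := hstep _ (by positivity) ih
      rwa [← mul_assoc, ← pow_succ'] at this
  have hl := tendsto_sechSum_one hx
  have hlim : Tendsto (fun n : ℕ => sechAlt (2 ^ n * x)) atTop (𝓝 1) := by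
    have := ((hl.comp (tendsto_add_atTop_nat 1)).const_mul 2).sub hl
    rw [show (2:ℝ) * 1 - 1 = 1 by norm_num] at this
    refine this.congr fun n => ?_
    simp only [Function.comp]
    rw [pow_succ', mul_assoc, sechAlt_mean (by positivity)]; ring
  have := le_of_tendsto' hlim fun n => not_lt.1 (hall n)
  norm_num at this

lemma gaussI_alt {x : ℝ} (hx : 0 < x) : gaussI (sechSum 0 x) (sechAlt x) = Real.pi / 2 := by
  have h := gaussI_agm (A := fun n => sechSum 0 (2 ^ n * x)) (B := fun n => sechAlt (2 ^ n * x))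
    (L := 1) (fun n => sechSum_pos 0 (by positivity)) (fun n => sechAlt_pos (by positivity))
    one_pos (fun n => by
      rw [pow_succ', mul_assoc, sechAlt_mean (by positivity)])
    (fun n => by
      rw [pow_succ' 2 n, mul_assoc, sechAlt_geom (by positivity)])
    (tendsto_sechSum_one hx)
  simpa using h

lemma gaussI_half {x : ℝ} (hx : 0 < x) :
    gaussI (sechSum 0 x) (sechSum (1/2) x) = x / 2 := by
  have hpi := Real.pi_pos
  have hd : ∀ n : ℕ, 2 * (x / 2 ^ (n + 1)) = x / 2 ^ n := fun n => by
    rw [pow_succ]; field_simp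
  have h := gaussI_agm (A := fun n => sechSum 0 (x / 2 ^ n) / 2 ^ n)
    (B := fun n => sechSum (1/2) (x / 2 ^ n) / 2 ^ n)
    (L := Real.pi / x) (fun n => div_pos (sechSum_pos 0 (by positivity)) (by positivity))
    (fun n => div_pos (sechSum_pos _ (by positivity)) (by positivity))
    (by positivity) (fun n => by
      rw [sechSum_split (show 0 < x / 2 ^ (n + 1) by positivity), hd, pow_succ]
      field_simp)
    (fun n => by
      rw [div_pow, sechSum_key (show 0 < x / 2 ^ (n + 1) by positivity), hd, pow_succ]
      field_simp
      ring)
    (tendsto_sechSum_zero hx)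
  simp only [pow_zero, div_one] at h
  rw [h]; field_simp

/-- `∑_{n=0}^∞ qⁿ/(1 + q^{2n}) = K(k_r)/(2π) + 1/4` with `q = e^{-π√r}`. -/
theorem stmt_6 (r : ℝ) (hr : 0 < r) (q : ℝ) (hq : q = Real.exp (-Real.pi * Real.sqrt r))
    (k : ℝ) (hk0 : 0 < k) (hk1 : k < 1)
    (hK : Kint (Real.sqrt (1 - k ^ 2)) = Real.sqrt r * Kint k) :
    (∑' n : ℕ, q ^ n / (1 + q ^ (2 * n))) = Kint k / (2 * Real.pi) + 1 / 4 := by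
  have hpi := Real.pi_pos
  have hsr : 0 < Real.sqrt r := Real.sqrt_pos.2 hr
  set x : ℝ := Real.pi * Real.sqrt r with hxdef
  have hx : 0 < x := by positivity
  have ha := sechSum_pos 0 hx
  have hb := sechAlt_pos hx
  have hc := sechSum_pos (1/2) hx
  have hsq := sechAlt_sq hx
  have h1 := gaussI_alt hx
  have h2 := gaussI_half hx
  set a := sechSum 0 x with hadef
  set b := sechAlt x
  set c := sechSum (1/2) x
  -- the modulus attached to `x`
  have hG1 : gaussI 1 (b / a) = Real.pi / 2 * a := by
    have := gaussI_scale a 1 (b / a) ha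
    rw [mul_one, mul_div_cancel₀ _ ha.ne', h1, eq_div_iff ha.ne'] at this
    exact this.symm
  have hG2 : gaussI 1 (c / a) = Real.sqrt r * (Real.pi / 2 * a) := by
    have := gaussI_scale a 1 (c / a) ha
    rw [mul_one, mul_div_cancel₀ _ ha.ne', h2, eq_div_iff ha.ne'] at this
    rw [← this, hxdef]; ring
  have hunit : (c / a) ^ 2 + (b / a) ^ 2 = 1 := by
    field_simp; linarith
  have hk2 : 0 < 1 - k ^ 2 := by nlinarith
  have hk' : 0 < Real.sqrt (1 - k ^ 2) := Real.sqrt_pos.2 hk2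
  have hksq := Real.sq_sqrt hk2.le
  set k' := Real.sqrt (1 - k ^ 2)
  have hKk : Kint k = gaussI 1 k' := Kint_eq k k' (by linarith)
  have hKk' : Kint k' = gaussI 1 k := Kint_eq k' k (by linarith)
  have hca : 0 < c / a := by positivity
  have hba : 0 < b / a := by positivity
  have hmain : Kint k = Real.pi / 2 * a := by
    rcases le_total k (c / a) with h | h
    · have h' : b / a ≤ k' := by
        apply le_of_sq_le_sq _ hk'.le
        nlinarith
      have e1 := gaussI_anti one_pos hba le_rfl h'
      have e2 := gaussI_anti one_pos hk0 le_rfl h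
      rw [← hKk, hG1] at e1
      rw [← hKk', hK, hG2] at e2
      exact le_antisymm e1 (le_of_mul_le_mul_left e2 hsr)
    · have h' : k' ≤ b / a := by
        apply le_of_sq_le_sq _ hba.le
        nlinarith
      have e1 := gaussI_anti one_pos hk' le_rfl h'
      have e2 := gaussI_anti one_pos hca le_rfl h
      rw [← hKk, hG1] at e1
      rw [← hKk', hK, hG2] at e2
      exact le_antisymm (le_of_mul_le_mul_left e2 hsr) e1
  have hterm : ∀ n : ℕ, q ^ n / (1 + q ^ (2 * n)) = (Real.cosh (n * x))⁻¹ / 2 := by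
    intro n
    have e : q ^ n = (Real.exp (n * x))⁻¹ := by
      rw [hq, ← Real.exp_nat_mul, ← Real.exp_neg]
      congr 1; rw [hxdef]; ring
    rw [mul_comm 2 n, pow_mul, e, Real.cosh_eq, Real.exp_neg]
    have := Real.exp_pos (n * x)
    field_simp
  have hnat := sechSum_nat hx
  rw [tsum_congr hterm, tsum_div_const, hmain]
  rw [← hadef] at hnat
  have e : Real.pi / 2 * a / (2 * Real.pi) = a / 4 := by field_simp; norm_num
  rw [e, hnat]
  ring
end

section
/- Let q and a be real with 0 < q < 1 and 0 < a < 1. Then the continued fraction u(a,q) converges, u(a,q) ≠ 1, and ((−a;q)_∞/(a;q)_∞)² = −1 + 2/(1 − u(a,q)). -/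
open Filter

/-- Numerator pairs `(p_{n-1}, p_n)` of the continued fraction
`c 1 / (b 1 + c 2 / (b 2 + ⋯))` (indices start at 1). -/
noncomputable def cfNum (c b : ℕ → ℝ) : ℕ → ℝ × ℝ
  | 0 => (1, 0)
  | n + 1 => ((cfNum c b n).2, b (n + 1) * (cfNum c b n).2 + c (n + 1) * (cfNum c b n).1)

/-- Denominator pairs `(q_{n-1}, q_n)` of the continued fraction. -/
noncomputable def cfDen (c b : ℕ → ℝ) : ℕ → ℝ × ℝ
  | 0 => (0, 1)
  | n + 1 => ((cfDen c b n).2, b (n + 1) * (cfDen c b n).2 + c (n + 1) * (cfDen c b n).1)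

/-- The continued fraction with partial numerators `c` and partial denominators `b`
(both indexed from 1) converges to `L`, i.e. its convergents tend to `L`. -/
def CFTendsto (c b : ℕ → ℝ) (L : ℝ) : Prop :=
  Tendsto (fun n => (cfNum c b n).2 / (cfDen c b n).2) atTop (nhds L)
/-- The q-Pochhammer infinite product `(a; q)_∞ = ∏_{n=0}^∞ (1 - a qⁿ)`. -/
noncomputable def qPoch (a q : ℝ) : ℝ := ∏' n : ℕ, (1 - a * q ^ n)


namespace S7

noncomputable def A (q : ℝ) (n m : ℕ) : ℝ := ∏ i ∈ Finset.range m, (1 + q ^ (n + i))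
noncomputable def B (q : ℝ) (k : ℕ) : ℝ := ∏ i ∈ Finset.range k, (1 - q ^ (2 * i + 2))
noncomputable def C (q : ℝ) (k : ℕ) : ℝ := ∏ i ∈ Finset.range k, (1 - q ^ (2 * i + 1))
noncomputable def D (q : ℝ) (k : ℕ) : ℝ := ∏ i ∈ Finset.range k, (1 - q ^ (i + 1))
noncomputable def T (q a : ℝ) (n k : ℕ) : ℝ := A q n (2 * k) / (B q k * C q (n + k)) * (a ^ 2) ^ k
noncomputable def X (q a : ℝ) (n : ℕ) : ℝ := ∑' k, T q a n k
noncomputable def t (q : ℝ) (m : ℕ) : ℝ := A q 0 m / D q m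
noncomputable def F (q x : ℝ) : ℝ := ∑' m, t q m * x ^ m

lemma A_succ (q : ℝ) (n m : ℕ) : A q n (m + 1) = A q n m * (1 + q ^ (n + m)) :=
  Finset.prod_range_succ _ _

lemma A_succ' (q : ℝ) (n m : ℕ) : A q n (m + 1) = (1 + q ^ n) * A q (n + 1) m := by
  unfold A
  rw [Finset.prod_range_succ', mul_comm]
  simp only [add_zero]
  congr 1
  apply Finset.prod_congr rfl
  intro i _
  rw [show n + (i + 1) = n + 1 + i by ring]

lemma B_succ (q : ℝ) (k : ℕ) : B q (k + 1) = B q k * (1 - q ^ (2 * k + 2)) :=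
  Finset.prod_range_succ _ _
lemma C_succ (q : ℝ) (k : ℕ) : C q (k + 1) = C q k * (1 - q ^ (2 * k + 1)) :=
  Finset.prod_range_succ _ _
lemma D_succ (q : ℝ) (k : ℕ) : D q (k + 1) = D q k * (1 - q ^ (k + 1)) :=
  Finset.prod_range_succ _ _

lemma D_even (q : ℝ) (k : ℕ) : D q (2 * k) = B q k * C q k := by
  induction k with
  | zero => simp [B, C, D]
  | succ k ih =>
    rw [show 2 * (k + 1) = 2 * k + 1 + 1 by ring, D_succ, D_succ, B_succ, C_succ, ih]
    ring

lemma f_pos {q : ℝ} (hq0 : 0 < q) (hq1 : q < 1) (n : ℕ) : 0 < 1 - q ^ (n + 1) := by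
  have := pow_lt_one₀ hq0.le hq1 (Nat.succ_ne_zero n)
  simpa using this

lemma A_pos {q : ℝ} (hq0 : 0 < q) (hq1 : q < 1) (n m : ℕ) : 0 < A q n m := Finset.prod_pos fun i _ => by positivity
lemma B_pos {q : ℝ} (hq0 : 0 < q) (hq1 : q < 1) (k : ℕ) : 0 < B q k := Finset.prod_pos fun i _ => f_pos hq0 hq1 _
lemma C_pos {q : ℝ} (hq0 : 0 < q) (hq1 : q < 1) (k : ℕ) : 0 < C q k := Finset.prod_pos fun i _ => f_pos hq0 hq1 _
lemma D_pos {q : ℝ} (hq0 : 0 < q) (hq1 : q < 1) (k : ℕ) : 0 < D q k := Finset.prod_pos fun i _ => f_pos hq0 hq1 _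
lemma t_pos {q : ℝ} (hq0 : 0 < q) (hq1 : q < 1) (k : ℕ) : 0 < t q k := div_pos (A_pos hq0 hq1 _ _) (D_pos hq0 hq1 _)

lemma t_succ {q : ℝ} (hq0 : 0 < q) (hq1 : q < 1) (m : ℕ) : t q (m + 1) * (1 - q ^ (m + 1)) = t q m * (1 + q ^ m) := by
  have h1 := (f_pos hq0 hq1 m).ne'
  have h2 := (D_pos hq0 hq1 m).ne'
  unfold t
  rw [D_succ, A_succ]
  field_simp
  simp

lemma T_zero {q : ℝ} (hq0 : 0 < q) (hq1 : q < 1) (a : ℝ) (n : ℕ) : T q a n 0 = (1 - q ^ (2 * n + 1)) * T q a (n + 1) 0 := by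
  have h1 := (f_pos hq0 hq1 (2 * n)).ne'
  have h2 := (C_pos hq0 hq1 n).ne'
  simp only [T, add_zero, C_succ, A, B, Finset.range_zero, Finset.prod_empty, mul_zero, pow_zero]
  field_simp

lemma T_rec {q : ℝ} (hq0 : 0 < q) (hq1 : q < 1) (a : ℝ) (n k : ℕ) : T q a n (k + 1) = (1 - q ^ (2 * n + 1)) * T q a (n + 1) (k + 1)
    + a ^ 2 * q ^ n * (1 + q ^ (n + 1)) ^ 2 * T q a (n + 2) k := by
  have h1 := (f_pos hq0 hq1 (2 * k + 1)).ne'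
  have h2 := (C_pos hq0 hq1 (n + k + 1)).ne'
  have h3 := (B_pos hq0 hq1 k).ne'
  have h4 := (f_pos hq0 hq1 (2 * (n + k + 1))).ne'
  unfold T
  rw [show n + (k + 1) = n + k + 1 by ring, show n + 1 + (k + 1) = n + k + 1 + 1 by ring,
    show n + 2 + k = n + k + 1 + 1 by ring, show 2 * (k + 1) = 2 * k + 1 + 1 by ring,
    A_succ' q n, A_succ q (n+1) (2 * k + 1), A_succ' q (n+1), C_succ q (n + k + 1), B_succ]
  rw [show n + 1 + 1 = n + 2 by ring]
  generalize A q (n + 2) (2 * k) = α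
  generalize C q (n + k + 1) = γ at *
  generalize B q k = β at *
  rw [show 2 * k + 1 + 1 = 2 * k + 2 by ring] at h1
  field_simp
  ring

lemma tend_pow {q : ℝ} (hq0 : 0 < q) (hq1 : q < 1) (f : ℕ → ℕ) (hf : ∀ k, k ≤ f k) :
    Tendsto (fun k => q ^ f k) atTop (nhds 0) :=
  (tendsto_pow_atTop_nhds_zero_of_lt_one hq0.le hq1).comp (tendsto_atTop_mono hf tendsto_id)

lemma T_pos {q : ℝ} (hq0 : 0 < q) (hq1 : q < 1) {a : ℝ} (ha0 : 0 < a) (n k : ℕ) : 0 < T q a n k := by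
  have := A_pos hq0 hq1 n (2 * k)
  have := B_pos hq0 hq1 k
  have := C_pos hq0 hq1 (n + k)
  unfold T
  positivity

lemma T_summable {q : ℝ} (hq0 : 0 < q) (hq1 : q < 1) {a : ℝ} (ha0 : 0 < a) (ha1 : a < 1) (n : ℕ) : Summable (T q a n) := by
  refine summable_of_ratio_test_tendsto_lt_one (l := a ^ 2) (by nlinarith)
    (Eventually.of_forall fun k => (T_pos hq0 hq1 ha0 n k).ne') ?_
  have h : ∀ k, ‖T q a n (k + 1)‖ / ‖T q a n k‖ =
      (1 + q ^ (n + 2 * k)) * (1 + q ^ (n + 2 * k + 1)) /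
        ((1 - q ^ (2 * k + 2)) * (1 - q ^ (2 * (n + k) + 1))) * a ^ 2 := by
    intro k
    rw [Real.norm_of_nonneg (T_pos hq0 hq1 ha0 n _).le,
      Real.norm_of_nonneg (T_pos hq0 hq1 ha0 n _).le]
    have h0 := (A_pos hq0 hq1 n (2 * k)).ne'
    have h1 := (f_pos hq0 hq1 (2 * k + 1)).ne'
    have h2 := (C_pos hq0 hq1 (n + k)).ne'
    have h3 := (B_pos hq0 hq1 k).ne'
    have h4 := (f_pos hq0 hq1 (2 * (n + k))).ne'
    rw [show 2 * k + 1 + 1 = 2 * k + 2 by ring] at h1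
    unfold T
    rw [show n + (k + 1) = n + k + 1 by ring, show 2 * (k + 1) = 2 * k + 1 + 1 by ring,
      A_succ, A_succ, C_succ, B_succ]
    rw [show n + (2 * k + 1) = n + 2 * k + 1 by ring, pow_succ (a ^ 2) k]
    field_simp
  simp_rw [h]
  have e1 := tend_pow hq0 hq1 (fun k => n + 2 * k) (fun k => by omega)
  have e2 := tend_pow hq0 hq1 (fun k => n + 2 * k + 1) (fun k => by omega)
  have e3 := tend_pow hq0 hq1 (fun k => 2 * k + 2) (fun k => by omega)
  have e4 := tend_pow hq0 hq1 (fun k => 2 * (n + k) + 1) (fun k => by omega)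
  have := ((((e1.const_add 1).mul (e2.const_add 1)).div
    ((e3.const_sub 1).mul (e4.const_sub 1)) (by norm_num)).mul_const (a ^ 2))
  simpa using this

lemma X_pos {q : ℝ} (hq0 : 0 < q) (hq1 : q < 1) {a : ℝ} (ha0 : 0 < a) (ha1 : a < 1) (n : ℕ) : 0 < X q a n :=
  (T_summable hq0 hq1 ha0 ha1 n).tsum_pos (fun k => (T_pos hq0 hq1 ha0 n k).le) 0
    (T_pos hq0 hq1 ha0 n 0)

lemma X_rec {q : ℝ} (hq0 : 0 < q) (hq1 : q < 1) {a : ℝ} (ha0 : 0 < a) (ha1 : a < 1) (n : ℕ) :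
    X q a n = (1 - q ^ (2 * n + 1)) * X q a (n + 1)
    + a ^ 2 * q ^ n * (1 + q ^ (n + 1)) ^ 2 * X q a (n + 2) := by
  have s0 := T_summable hq0 hq1 ha0 ha1 n
  have s1 := T_summable hq0 hq1 ha0 ha1 (n + 1)
  have s2 := T_summable hq0 hq1 ha0 ha1 (n + 2)
  unfold X
  rw [s0.tsum_eq_zero_add, s1.tsum_eq_zero_add, T_zero hq0 hq1]
  simp_rw [T_rec hq0 hq1 a n]
  rw [Summable.tsum_add (((summable_nat_add_iff 1).2 s1).mul_left _) (s2.mul_left _),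
    tsum_mul_left, tsum_mul_left]
  ring

lemma t_summable {q : ℝ} (hq0 : 0 < q) (hq1 : q < 1) {x : ℝ} (hx : |x| < 1) : Summable (fun m => t q m * x ^ m) := by
  by_cases hx0 : x = 0
  · subst hx0
    apply summable_of_ne_finset_zero (s := {0})
    intro b hb
    have : b ≠ 0 := by simpa using hb
    simp [this]
  refine summable_of_ratio_test_tendsto_lt_one (l := |x|) hx
    (Eventually.of_forall fun k => mul_ne_zero (t_pos hq0 hq1 k).ne' (pow_ne_zero _ hx0)) ?_
  have h : ∀ k, ‖t q (k + 1) * x ^ (k + 1)‖ / ‖t q k * x ^ k‖ =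
      (1 + q ^ k) / (1 - q ^ (k + 1)) * |x| := by
    intro k
    have h0 := t_succ hq0 hq1 k
    have h1 := (f_pos hq0 hq1 k).ne'
    have h2 := (t_pos hq0 hq1 k).ne'
    have hx' : |x| ≠ 0 := abs_ne_zero.2 hx0
    rw [norm_mul, norm_mul, Real.norm_of_nonneg (t_pos hq0 hq1 _).le,
      Real.norm_of_nonneg (t_pos hq0 hq1 _).le, norm_pow, norm_pow, Real.norm_eq_abs,
      (eq_div_iff h1).2 h0, pow_succ |x| k]
    field_simp
  simp_rw [h]
  have e1 := tend_pow hq0 hq1 (fun k => k) (fun k => le_rfl)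
  have e2 := tend_pow hq0 hq1 (fun k => k + 1) (fun k => by omega)
  have := ((e1.const_add 1).div (e2.const_sub 1) (by norm_num)).mul_const |x|
  simpa using this

lemma abs_q {q : ℝ} (hq0 : 0 < q) (hq1 : q < 1) {x : ℝ} (hx : |x| < 1) (N : ℕ) : |x * q ^ N| < 1 := by
  rw [abs_mul, abs_of_nonneg (pow_nonneg hq0.le N)]
  have := pow_le_one₀ (n := N) hq0.le hq1.le
  have := pow_nonneg hq0.le N
  nlinarith [abs_nonneg x]

lemma F_fun {q : ℝ} (hq0 : 0 < q) (hq1 : q < 1) {x : ℝ} (hx : |x| < 1) : (1 - x) * F q x = (1 + x) * F q (x * q) := by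
  have s := t_summable hq0 hq1 hx
  have s' := t_summable hq0 hq1 (x := x * q) (by simpa using abs_q hq0 hq1 hx 1)
  have h1 : F q x - F q (x * q) = x * (F q x + F q (x * q)) := by
    unfold F
    rw [← s.tsum_sub s', ← s.tsum_add s', ← tsum_mul_left, (s.sub s').tsum_eq_zero_add]
    simp only [pow_zero, sub_self, zero_add]
    congr 1
    ext m
    have := t_succ hq0 hq1 m
    rw [mul_pow, mul_pow]
    linear_combination x ^ (m + 1) * this
  linear_combination h1

lemma F_iter {q : ℝ} (hq0 : 0 < q) (hq1 : q < 1) {x : ℝ} (hx : |x| < 1) (N : ℕ) :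
    (∏ n ∈ Finset.range N, (1 - x * q ^ n)) * F q x =
      (∏ n ∈ Finset.range N, (1 - (-x) * q ^ n)) * F q (x * q ^ N) := by
  induction N with
  | zero => simp
  | succ N ih =>
    have := F_fun hq0 hq1 (abs_q hq0 hq1 hx N)
    rw [Finset.prod_range_succ, Finset.prod_range_succ, pow_succ, ← mul_assoc x]
    linear_combination (1 - x * q ^ N) * ih +
      (∏ n ∈ Finset.range N, (1 - (-x) * q ^ n)) * this

lemma F_tend {q : ℝ} (hq0 : 0 < q) (hq1 : q < 1) {x : ℝ} (hx : |x| < 1) : Tendsto (fun N => F q (x * q ^ N)) atTop (nhds 1) := by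
  have s := t_summable hq0 hq1 (x := |x|) (by simpa using hx)
  have key := tendsto_tsum_of_dominated_convergence (𝓕 := atTop)
    (f := fun (N : ℕ) m => t q m * (x * q ^ N) ^ m)
    (g := fun m => t q m * (0 : ℝ) ^ m) s ?_ ?_
  · have : ∑' m, t q m * (0 : ℝ) ^ m = 1 := by
      rw [tsum_eq_single 0]
      · simp [t, A, D]
      · intro b hb; simp [hb]
    rw [this] at key
    exact key
  · intro m
    have e := tend_pow hq0 hq1 (fun k => k) (fun k => le_rfl)
    have := ((e.const_mul x).pow m).const_mul (t q m)
    simpa using this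
  · refine Eventually.of_forall fun N m => ?_
    rw [norm_mul, Real.norm_of_nonneg (t_pos hq0 hq1 _).le, norm_pow, Real.norm_eq_abs]
    have := (t_pos hq0 hq1 m).le
    have h1 : |x * q ^ N| ≤ |x| := by
      rw [abs_mul, abs_of_nonneg (pow_nonneg hq0.le N)]
      exact mul_le_of_le_one_right (abs_nonneg x) (pow_le_one₀ hq0.le hq1.le)
    gcongr

lemma P_tend {q : ℝ} (hq0 : 0 < q) (hq1 : q < 1) (x : ℝ) : Tendsto (fun N => ∏ n ∈ Finset.range N, (1 - x * q ^ n)) atTop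
    (nhds (qPoch x q)) := by
  have h : Summable (fun n : ℕ => ‖-(x * q ^ n)‖) :=
    ((summable_geometric_of_lt_one hq0.le hq1).mul_left x).neg.norm
  have := (multipliable_one_add_of_summable h).hasProd.tendsto_prod_nat
  simpa only [qPoch, ← sub_eq_add_neg] using this

lemma F_P {q : ℝ} (hq0 : 0 < q) (hq1 : q < 1) {x : ℝ} (hx : |x| < 1) : qPoch x q * F q x = qPoch (-x) q := by
  have h1 := (P_tend hq0 hq1 x).mul_const (F q x)
  have h2 := (P_tend hq0 hq1 (-x)).mul (F_tend hq0 hq1 hx)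
  simp_rw [F_iter hq0 hq1 hx] at h1
  simpa using tendsto_nhds_unique h1 h2

lemma P_ge {q : ℝ} (hq0 : 0 < q) (hq1 : q < 1) {a : ℝ} (ha0 : 0 < a) : 1 ≤ qPoch (-a) q := by
  refine ge_of_tendsto' (P_tend hq0 hq1 (-a)) fun N => ?_
  induction N with
  | zero => simp
  | succ N ih =>
    rw [Finset.prod_range_succ]
    have := mul_pos ha0 (pow_pos hq0 N)
    exact one_le_mul_of_one_le_of_one_le ih (by linarith)

lemma X_zero_eq {q : ℝ} (hq0 : 0 < q) (hq1 : q < 1) {a : ℝ} (ha0 : 0 < a) (ha1 : a < 1) :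
    F q a = X q a 0 + 2 * a * X q a 1 ∧ F q (-a) = X q a 0 - 2 * a * X q a 1 := by
  have e : ∀ k, T q a 0 k = t q (2 * k) * a ^ (2 * k) := by
    intro k
    rw [T, t, D_even, zero_add, pow_mul]
  have o : ∀ k, 2 * a * T q a 1 k = t q (2 * k + 1) * a ^ (2 * k + 1) := by
    intro k
    rw [T, t, D_succ, D_even, A_succ', add_comm 1 k, C_succ, pow_succ, pow_mul]
    simp only [pow_zero]
    ring
  have h0 : HasSum (T q a 0) (X q a 0) := (T_summable hq0 hq1 ha0 ha1 0).hasSum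
  have h1 : HasSum (fun k => 2 * a * T q a 1 k) (2 * a * X q a 1) :=
    (T_summable hq0 hq1 ha0 ha1 1).hasSum.mul_left (2 * a)
  constructor
  · rw [funext e] at h0
    rw [funext o] at h1
    exact (HasSum.even_add_odd (f := fun m => t q m * a ^ m) h0 h1).tsum_eq
  · have h1 := h1.neg
    have e' : ∀ k, T q a 0 k = t q (2 * k) * (-a) ^ (2 * k) := by
      intro k; rw [e, (even_two_mul k).neg_pow]
    have o' : ∀ k, -(2 * a * T q a 1 k) = t q (2 * k + 1) * (-a) ^ (2 * k + 1) := by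
      intro k; rw [o, (odd_two_mul_add_one k).neg_pow]; ring
    rw [funext e'] at h0
    rw [funext o'] at h1
    rw [sub_eq_add_neg]
    exact (HasSum.even_add_odd (f := fun m => t q m * (-a) ^ m) h0 h1).tsum_eq

/-- A positive solution of the recurrence gives the value of the continued fraction. -/
lemma cf_conv (c b Y : ℕ → ℝ) (δ : ℝ) (hδ : 0 < δ) (hb : ∀ n, δ ≤ b (n + 1))
    (hc : ∀ n, 0 < c (n + 1)) (hc0 : Tendsto (fun n => c (n + 1)) atTop (nhds 0))
    (hY : ∀ n, 0 < Y n)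
    (hrec : ∀ n, Y n = b (n + 1) * Y (n + 1) + c (n + 2) * Y (n + 2)) :
    CFTendsto c b (c 1 * Y 1 / Y 0) := by
  have dpos : ∀ n, 0 ≤ (cfDen c b n).1 ∧ δ ^ n ≤ (cfDen c b n).2 := by
    intro n
    induction n with
    | zero => simp [cfDen]
    | succ n ih =>
      have h := pow_pos hδ n
      refine ⟨by simp only [cfDen]; linarith, ?_⟩
      simp only [cfDen]
      have := mul_nonneg (hc n).le ih.1
      have := mul_le_mul (hb n) ih.2 h.le (hδ.le.trans (hb n))
      rw [pow_succ]; linarith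
  have d2 : ∀ n, 0 < (cfDen c b n).2 := fun n => (pow_pos hδ n).trans_le (dpos n).2
  have hden : ∀ n, Y 0 = (cfDen c b n).2 * Y n + (cfDen c b n).1 * (c (n + 1) * Y (n + 1)) := by
    intro n
    induction n with
    | zero => simp [cfDen]
    | succ n ih =>
      simp only [cfDen]
      rw [ih]
      linear_combination (cfDen c b n).2 * hrec n
  have hnum : ∀ n, c 1 * Y 1 =
      (cfNum c b n).2 * Y n + (cfNum c b n).1 * (c (n + 1) * Y (n + 1)) := by
    intro n
    induction n with
    | zero => simp [cfNum]
    | succ n ih =>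
      simp only [cfNum]
      rw [ih]
      linear_combination (cfNum c b n).2 * hrec n
  have hdet : ∀ n, |(cfNum c b n).2 * (cfDen c b n).1 - (cfDen c b n).2 * (cfNum c b n).1| =
      ∏ i ∈ Finset.range n, c (i + 1) := by
    intro n
    induction n with
    | zero => simp [cfDen, cfNum]
    | succ n ih =>
      rw [Finset.prod_range_succ, ← ih, ← abs_of_pos (hc n), ← abs_mul, ← abs_neg]
      simp only [cfDen, cfNum]
      congr 1
      ring
  set r : ℕ → ℝ := fun n => ∏ i ∈ Finset.range n, (c (i + 1) / δ ^ 2) with hr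
  have rpos : ∀ n, 0 < r n := fun n =>
    Finset.prod_pos fun i _ => div_pos (hc i) (by positivity)
  have rs : Tendsto r atTop (nhds 0) := by
    apply Summable.tendsto_atTop_zero
    refine summable_of_ratio_test_tendsto_lt_one (l := 0) (by norm_num)
      (Eventually.of_forall fun k => (rpos k).ne') ?_
    have : ∀ n, ‖r (n + 1)‖ / ‖r n‖ = c (n + 1) / δ ^ 2 := by
      intro n
      rw [Real.norm_of_nonneg (rpos _).le, Real.norm_of_nonneg (rpos _).le,
        div_eq_iff (rpos n).ne']
      simp only [hr, Finset.prod_range_succ]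
      ring
    simp_rw [this]
    simpa using hc0.div_const (δ ^ 2)
  unfold CFTendsto
  rw [← tendsto_add_atTop_iff_nat 1, tendsto_iff_norm_sub_tendsto_zero]
  have rs1 := ((rs.comp (tendsto_add_atTop_nat 1)).mul_const δ)
  rw [zero_mul] at rs1
  refine squeeze_zero (fun _ => norm_nonneg _) (fun n => ?_) rs1
  have hY0 := hY 0
  have hd := d2 (n + 1)
  have hdn := d2 n
  have e : (cfNum c b (n + 1)).2 / (cfDen c b (n + 1)).2 - c 1 * Y 1 / Y 0 =
      ((cfNum c b (n + 1)).2 * (cfDen c b (n + 1)).1 - (cfDen c b (n + 1)).2 * (cfNum c b (n + 1)).1)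
      * (c (n + 2) * Y (n + 2) / ((cfDen c b (n + 1)).2 * Y 0)) := by
    rw [div_sub_div _ _ hd.ne' hY0.ne', mul_div_assoc']
    congr 1
    have h1 := hden (n + 1)
    have h2 := hnum (n + 1)
    linear_combination (cfNum c b (n + 1)).2 * h1 - (cfDen c b (n + 1)).2 * h2
  have hcY : 0 < c (n + 2) * Y (n + 2) := mul_pos (hc (n + 1)) (hY _)
  have hle : c (n + 2) * Y (n + 2) / ((cfDen c b (n + 1)).2 * Y 0) ≤
      δ / (δ ^ 2) ^ (n + 1) := by
    have h1 : (cfDen c b n).2 * (c (n + 2) * Y (n + 2)) ≤ Y 0 := by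
      have h := hden (n + 1)
      have := mul_pos hd (hY (n + 1))
      have e1 : (cfDen c b (n + 1)).1 = (cfDen c b n).2 := rfl
      rw [e1] at h
      linarith
    have h2 : δ ^ n * (c (n + 2) * Y (n + 2)) ≤ Y 0 :=
      (mul_le_mul_of_nonneg_right (dpos n).2 hcY.le).trans h1
    have h3 := (dpos (n + 1)).2
    rw [div_le_div_iff₀ (by positivity) (by positivity)]
    calc c (n + 2) * Y (n + 2) * (δ ^ 2) ^ (n + 1)
        = δ * (δ ^ (n + 1) * (δ ^ n * (c (n + 2) * Y (n + 2)))) := by ring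
      _ ≤ δ * ((cfDen c b (n + 1)).2 * Y 0) := by gcongr
  rw [e, norm_mul, Real.norm_eq_abs, hdet,
    Real.norm_of_nonneg (div_nonneg hcY.le (mul_pos hd hY0).le)]
  have hp : 0 ≤ ∏ i ∈ Finset.range (n + 1), c (i + 1) := Finset.prod_nonneg fun i _ => (hc i).le
  refine (mul_le_mul_of_nonneg_left hle hp).trans (le_of_eq ?_)
  simp only [hr, Function.comp, Finset.prod_div_distrib, Finset.prod_const, Finset.card_range]
  ring

end S7

/-- Proposition 6: the continued fraction
`u(a,q) = 2a/(1-q +) a²(1+q)²/(1-q³ +) a²q(1+q²)²/(1-q⁵ +) ⋯` converges to some `L ≠ 1`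
and `((-a;q)_∞/(a;q)_∞)² = -1 + 2/(1 - u(a,q))`. -/
theorem stmt_7 (q a : ℝ) (hq0 : 0 < q) (hq1 : q < 1) (ha0 : 0 < a) (ha1 : a < 1) :
    ∃ L : ℝ,
      CFTendsto
        (fun n => if n = 1 then 2 * a else a ^ 2 * q ^ (n - 2) * (1 + q ^ (n - 1)) ^ 2)
        (fun n => 1 - q ^ (2 * n - 1)) L ∧
      L ≠ 1 ∧
      (qPoch (-a) q / qPoch a q) ^ 2 = -1 + 2 / (1 - L) := by
  refine ⟨2 * a * S7.X q a 1 / S7.X q a 0, ?_, ?_⟩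
  · have := S7.cf_conv
      (fun n => if n = 1 then 2 * a else a ^ 2 * q ^ (n - 2) * (1 + q ^ (n - 1)) ^ 2)
      (fun n => 1 - q ^ (2 * n - 1)) (S7.X q a) (1 - q) (by linarith) ?_ ?_ ?_
      (S7.X_pos hq0 hq1 ha0 ha1) ?_
    · simpa using this
    · intro n
      have h := pow_le_of_le_one (n := 2 * n + 1) hq0.le hq1.le (by omega)
      have e : 2 * (n + 1) - 1 = 2 * n + 1 := by omega
      simp only [e]
      linarith
    · intro n
      split_ifs
      · linarith
      · positivity
    · rw [← tendsto_add_atTop_iff_nat 1]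
      have e1 := S7.tend_pow hq0 hq1 (fun k => k) (fun k => le_rfl)
      have e2 := S7.tend_pow hq0 hq1 (fun k => k + 1) (fun k => by omega)
      have := (e1.const_mul (a ^ 2)).mul ((e2.const_add 1).pow 2)
      simpa using this
    · intro n
      have h := S7.X_rec hq0 hq1 ha0 ha1 n
      have e : 2 * (n + 1) - 1 = 2 * n + 1 := by omega
      simpa [e] using h
  · have hx : |a| < 1 := by rwa [abs_of_pos ha0]
    have hP := S7.P_ge hq0 hq1 ha0
    have h1 := S7.F_P hq0 hq1 hx
    have h2 := S7.F_P hq0 hq1 (x := -a) (by simpa using hx)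
    rw [neg_neg] at h2
    obtain ⟨f1, f2⟩ := S7.X_zero_eq hq0 hq1 ha0 ha1
    have hX := (S7.X_pos hq0 hq1 ha0 ha1 0).ne'
    have hPm : qPoch (-a) q ≠ 0 := by linarith
    have hPa : qPoch a q ≠ 0 := by
      intro h
      rw [h, zero_mul] at h1
      exact hPm h1.symm
    have hFm : S7.F q (-a) ≠ 0 := by
      intro h
      rw [h, mul_zero] at h2
      exact hPa h2.symm
    have hL : 1 - 2 * a * S7.X q a 1 / S7.X q a 0 = S7.F q (-a) / S7.X q a 0 := by
      rw [f2]
      field_simp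
    have hX2 : 2 * S7.X q a 0 = S7.F q a + S7.F q (-a) := by rw [f1, f2]; ring
    refine ⟨?_, ?_⟩
    · intro h
      rw [h, sub_self] at hL
      exact div_ne_zero hFm hX hL.symm
    · rw [hL]
      have hR : -1 + 2 / (S7.F q (-a) / S7.X q a 0) = S7.F q a / S7.F q (-a) := by
        field_simp
        linear_combination hX2
      rw [hR, div_pow, div_eq_div_iff (by positivity) hFm]
      linear_combination qPoch (-a) q * h2 - qPoch a q * h1
end

section
/- Let r > 0, set q = e^{−π√r}, assume k_r ∈ (0,1) satisfies K(√(1 − k_r²)) = √r · K(k_r), and let k'_r = √(1 − k_r²). Then for every positive integer ν, 4·∑_{n=0}^{∞} q^{ν(2n+1)}/((2n+1)(1 − q^{2n+1})) = −4·∑_{j=1}^{ν−1} arctanh(q^j) − log(2·k'_r·K(k_r)/π), where the finite sum is empty (equal to 0) when ν = 1. -/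
/-- The inverse hyperbolic tangent. -/
noncomputable def arctanh (x : ℝ) : ℝ := Real.log ((1 + x) / (1 - x)) / 2


open Real Filter Topology

/-- The symmetric elliptic integral. -/
noncomputable def EI (a b : ℝ) : ℝ :=
  ∫ t in (0 : ℝ)..(π / 2), 1 / √(a ^ 2 * cos t ^ 2 + b ^ 2 * sin t ^ 2)

lemma quad_pos {a b : ℝ} (ha : 0 < a) (hb : 0 < b) (t : ℝ) :
    0 < a * cos t ^ 2 + b * sin t ^ 2 := by
  have h := sin_sq_add_cos_sq t
  by_cases hc : cos t = 0
  · have : sin t ^ 2 = 1 := by rw [← h, hc]; ring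
    rw [hc, this]; simpa using hb
  · have : 0 < cos t ^ 2 := by positivity
    positivity

lemma EI_cont {a b : ℝ} (ha : 0 < a) (hb : 0 < b) :
    Continuous (fun t : ℝ => 1 / √(a ^ 2 * cos t ^ 2 + b ^ 2 * sin t ^ 2)) := by
  refine Continuous.div continuous_const (by fun_prop) (fun t => ?_)
  exact (sqrt_pos.2 (quad_pos (pow_pos ha 2) (pow_pos hb 2) t)).ne'

lemma Kint_eq_EI {k : ℝ} (hk0 : 0 ≤ k) (hk1 : k ≤ 1) : Kint k = EI 1 (√(1 - k ^ 2)) := by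
  unfold Kint EI
  congr 1
  ext t
  rw [sq_sqrt (by nlinarith)]
  congr 2
  have := sin_sq_add_cos_sq t
  linear_combination -this

lemma EI_scale {a b c : ℝ} (hc : 0 < c) : EI (c * a) (c * b) = EI a b / c := by
  unfold EI
  rw [← intervalIntegral.integral_div]
  congr 1
  ext t
  have : (c * a) ^ 2 * cos t ^ 2 + (c * b) ^ 2 * sin t ^ 2
    = c ^ 2 * (a ^ 2 * cos t ^ 2 + b ^ 2 * sin t ^ 2) := by ring
  rw [this, sqrt_mul (by positivity), sqrt_sq hc.le, div_div, mul_comm]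

lemma EI_pi {a b : ℝ} (ha : 0 < a) (hb : 0 < b) :
    ∫ t in (0 : ℝ)..π, 1 / √(a ^ 2 * cos t ^ 2 + b ^ 2 * sin t ^ 2) = 2 * EI a b := by
  have hc := EI_cont ha hb
  rw [← intervalIntegral.integral_add_adjacent_intervals
    (hc.intervalIntegrable 0 (π / 2)) (hc.intervalIntegrable (π / 2) π)]
  have h2 : ∫ t in (π / 2 : ℝ)..π, 1 / √(a ^ 2 * cos t ^ 2 + b ^ 2 * sin t ^ 2) = EI a b := by
    have := intervalIntegral.integral_comp_sub_left (a := π / 2) (b := π)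
      (fun t : ℝ => 1 / √(a ^ 2 * cos t ^ 2 + b ^ 2 * sin t ^ 2)) π
    simp only [cos_pi_sub, sin_pi_sub, neg_sq, sub_self] at this
    rw [this]
    unfold EI
    congr 1
    ring
  rw [h2]
  unfold EI
  ring

lemma EI_landen {a b c : ℝ} (ha : 0 < a) (hb : 0 < b) (hc : 0 < c) (hcc : c ^ 2 = a * b) :
    EI ((a + b) / 2) c = EI a b := by
  set f : ℝ → ℝ := fun t => 2 * t -
    arctan ((a - b) * (sin t * cos t) / (a * cos t ^ 2 + b * sin t ^ 2)) with hf
  set f' : ℝ → ℝ := fun t => (a + b) * (a * cos t ^ 2 + b * sin t ^ 2) /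
    (a ^ 2 * cos t ^ 2 + b ^ 2 * sin t ^ 2) with hf'
  have hq := quad_pos ha hb
  have hQ := quad_pos (pow_pos ha 2) (pow_pos hb 2)
  have hsum : ∀ t, 1 + ((a - b) * (sin t * cos t) / (a * cos t ^ 2 + b * sin t ^ 2)) ^ 2 =
      (a ^ 2 * cos t ^ 2 + b ^ 2 * sin t ^ 2) / (a * cos t ^ 2 + b * sin t ^ 2) ^ 2 := by
    intro t
    have := (hq t).ne'
    field_simp
    rw [sin_sq]
    ring
  have hder : ∀ t, HasDerivAt f (f' t) t := by
    intro t
    have hn : HasDerivAt (fun t => (a - b) * (sin t * cos t))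
        ((a - b) * (cos t * cos t + sin t * (-sin t))) t :=
      ((hasDerivAt_sin t).mul (hasDerivAt_cos t)).const_mul _
    have hd : HasDerivAt (fun t => a * cos t ^ 2 + b * sin t ^ 2)
        (a * (2 * cos t * (-sin t)) + b * (2 * sin t * cos t)) t := by
      have h1 := ((hasDerivAt_cos t).pow 2).const_mul a
      have h2 := ((hasDerivAt_sin t).pow 2).const_mul b
      refine (h1.add h2).congr_deriv ?_
      simp
    have h3 := ((hasDerivAt_id t).const_mul 2).sub (hn.div hd (hq t).ne').arctan
    refine h3.congr_deriv ?_
    simp only [Pi.div_apply, hsum t, hf']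
    have e1 := (hq t).ne'
    have e2 := (hQ t).ne'
    field_simp
    have e3 : sin t ^ 2 = 1 - cos t ^ 2 := sin_sq t
    have e4 : sin t ^ 4 = (1 - cos t ^ 2) ^ 2 := by rw [← e3]; ring
    have e5 : sin t ^ 6 = (1 - cos t ^ 2) ^ 3 := by rw [← e3]; ring
    ring_nf
    simp only [e3, e4]
    ring
  have hcos : ∀ t, cos (f t) ^ 2 * (a ^ 2 * cos t ^ 2 + b ^ 2 * sin t ^ 2) =
      (a * cos t ^ 2 - b * sin t ^ 2) ^ 2 := by
    intro t
    simp only [hf]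
    rw [cos_sub, cos_arctan, sin_arctan, hsum, sqrt_div (hQ t).le, sqrt_sq (hq t).le,
      cos_two_mul, sin_two_mul]
    have e0 := sqrt_pos.2 (hQ t)
    have e1 := (hq t).ne'
    have e2 : √(a ^ 2 * cos t ^ 2 + b ^ 2 * sin t ^ 2) ^ 2
      = a ^ 2 * cos t ^ 2 + b ^ 2 * sin t ^ 2 := sq_sqrt (hQ t).le
    have e3 : sin t ^ 2 = 1 - cos t ^ 2 := sin_sq t
    have e4 : (2 * cos t ^ 2 - 1) * (1 / (√(a ^ 2 * cos t ^ 2 + b ^ 2 * sin t ^ 2) /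
        (a * cos t ^ 2 + b * sin t ^ 2))) + 2 * sin t * cos t *
        ((a - b) * (sin t * cos t) / (a * cos t ^ 2 + b * sin t ^ 2) /
        (√(a ^ 2 * cos t ^ 2 + b ^ 2 * sin t ^ 2) / (a * cos t ^ 2 + b * sin t ^ 2))) =
        (a * cos t ^ 2 - b * sin t ^ 2) / √(a ^ 2 * cos t ^ 2 + b ^ 2 * sin t ^ 2) := by
      generalize √(a ^ 2 * cos t ^ 2 + b ^ 2 * sin t ^ 2) = D at e0
      rw [div_div_div_cancel_right₀ e1, one_div_div]
      field_simp
      linear_combination (2 * a * cos t ^ 2) * e3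
    rw [e4, div_pow, e2]
    exact div_mul_cancel₀ _ (hQ t).ne'
  have hcont : ContinuousOn f' (Set.uIcc 0 (π / 2)) := by
    apply Continuous.continuousOn
    refine Continuous.div (by fun_prop) (by fun_prop) (fun t => (hQ t).ne')
  have hab : 0 < (a + b) / 2 := by positivity
  have key := intervalIntegral.integral_comp_mul_deriv (fun x _ => hder x) hcont (EI_cont hab hc)
  have hf0 : f 0 = 0 := by simp [hf]
  have hf1 : f (π / 2) = π := by simp [hf]; ring
  rw [hf0, hf1, EI_pi hab hc] at key
  have : ∫ x in (0:ℝ)..π / 2, ((fun t => 1 / √(((a + b) / 2) ^ 2 * cos t ^ 2 + c ^ 2 * sin t ^ 2)) ∘ f)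
      x * f' x = 2 * EI a b := by
    unfold EI
    rw [← intervalIntegral.integral_const_mul]
    congr 1
    ext t
    simp only [Function.comp, hf']
    have e2 := (hQ t)
    have e1 := (hq t)
    have : ((a + b) / 2) ^ 2 * cos (f t) ^ 2 + c ^ 2 * sin (f t) ^ 2 =
        ((a + b) / 2 * (a * cos t ^ 2 + b * sin t ^ 2)) ^ 2 /
          (a ^ 2 * cos t ^ 2 + b ^ 2 * sin t ^ 2) := by
      rw [hcc, sin_sq (f t), eq_div_iff e2.ne']
      have e3 : sin t ^ 2 = 1 - cos t ^ 2 := sin_sq t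
      have := hcos t
      rw [e3] at this ⊢
      linear_combination (((a + b) / 2) ^ 2 - a * b) * this
    rw [this, sqrt_div (by positivity), sqrt_sq (by positivity)]
    have e4 := sqrt_pos.2 e2
    have e5 : √(a ^ 2 * cos t ^ 2 + b ^ 2 * sin t ^ 2) ^ 2
      = a ^ 2 * cos t ^ 2 + b ^ 2 * sin t ^ 2 := sq_sqrt e2.le
    conv_lhs => rw [← e5]
    rw [sqrt_sq e4.le]
    field_simp
  linarith

lemma EI_bounds {a b m M : ℝ} (hm : 0 < m) (ha : m ≤ a) (hb : m ≤ b) (ha' : a ≤ M) (hb' : b ≤ M) :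
    π / 2 / M ≤ EI a b ∧ EI a b ≤ π / 2 / m := by
  have ha0 : 0 < a := hm.trans_le ha
  have hb0 : 0 < b := hm.trans_le hb
  have hM : 0 < M := ha0.trans_le ha'
  have hp : (0:ℝ) ≤ π / 2 := by positivity
  have hlo : ∀ t, m ≤ √(a ^ 2 * cos t ^ 2 + b ^ 2 * sin t ^ 2) := by
    intro t
    apply le_sqrt_of_sq_le
    have h1 : m ^ 2 ≤ a ^ 2 := by gcongr
    have h2 : m ^ 2 ≤ b ^ 2 := by gcongr
    have := sin_sq_add_cos_sq t
    nlinarith [sq_nonneg (cos t), sq_nonneg (sin t)]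
  have hhi : ∀ t, √(a ^ 2 * cos t ^ 2 + b ^ 2 * sin t ^ 2) ≤ M := by
    intro t
    apply sqrt_le_iff.2 ⟨hM.le, ?_⟩
    have h1 : a ^ 2 ≤ M ^ 2 := by gcongr
    have h2 : b ^ 2 ≤ M ^ 2 := by gcongr
    have := sin_sq_add_cos_sq t
    nlinarith [sq_nonneg (cos t), sq_nonneg (sin t)]
  have hi := (EI_cont ha0 hb0).intervalIntegrable (μ := MeasureTheory.volume) 0 (π / 2)
  constructor
  · have : π / 2 / M = ∫ t in (0:ℝ)..(π / 2), 1 / M := by simp; ring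
    rw [this]
    refine intervalIntegral.integral_mono_on hp (by simp) hi (fun t _ => ?_)
    exact one_div_le_one_div_of_le (hm.trans_le (hlo t)) (hhi t)
  · have : π / 2 / m = ∫ t in (0:ℝ)..(π / 2), 1 / m := by simp; ring
    rw [this]
    refine intervalIntegral.integral_mono_on hp hi (by simp) (fun t _ => ?_)
    exact one_div_le_one_div_of_le hm (hlo t)

lemma EI_tendsto {a b : ℕ → ℝ} (ha : Tendsto a atTop (𝓝 1)) (hb : Tendsto b atTop (𝓝 1)) :
    Tendsto (fun n => EI (a n) (b n)) atTop (𝓝 (π / 2)) := by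
  have hmin := ha.min hb
  have hmax := ha.max hb
  simp only [min_self, max_self] at hmin hmax
  have h1 := (tendsto_const_nhds (x := π / 2)).div hmax one_ne_zero
  have h2 := (tendsto_const_nhds (x := π / 2)).div hmin one_ne_zero
  rw [div_one] at h1 h2
  have hev : ∀ᶠ n in atTop, 0 < min (a n) (b n) := hmin.eventually (lt_mem_nhds one_pos)
  refine tendsto_of_tendsto_of_tendsto_of_le_of_le' h1 h2 ?_ ?_
  · filter_upwards [hev] with n hn
    exact (EI_bounds hn (min_le_left _ _) (min_le_right _ _) (le_max_left _ _) (le_max_right _ _)).1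
  · filter_upwards [hev] with n hn
    exact (EI_bounds hn (min_le_left _ _) (min_le_right _ _) (le_max_left _ _) (le_max_right _ _)).2

lemma Kint_lt {x y : ℝ} (hx : 0 ≤ x) (hxy : x < y) (hy : y < 1) : Kint x < Kint y := by
  have hpos : ∀ z : ℝ, 0 ≤ z → z < 1 → ∀ t, 0 < 1 - z ^ 2 * sin t ^ 2 := by
    intro z hz hz1 t
    have := sin_sq_le_one t
    have : z ^ 2 < 1 := by nlinarith
    nlinarith [sq_nonneg (sin t), sq_nonneg z]
  have hc : ∀ z : ℝ, 0 ≤ z → z < 1 → Continuous (fun t : ℝ => 1 / √(1 - z ^ 2 * sin t ^ 2)) := by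
    intro z hz hz1
    exact Continuous.div continuous_const (by fun_prop)
      (fun t => (sqrt_pos.2 (hpos z hz hz1 t)).ne')
  have hy0 : 0 ≤ y := by linarith
  have hsq : x ^ 2 < y ^ 2 := by nlinarith
  unfold Kint
  refine intervalIntegral.integral_lt_integral_of_continuousOn_of_le_of_exists_lt (by positivity)
    (hc x hx (by linarith)).continuousOn (hc y hy0 hy).continuousOn (fun t _ => ?_)
    ⟨π / 2, ⟨by positivity, le_rfl⟩, ?_⟩
  · apply one_div_le_one_div_of_le (sqrt_pos.2 (hpos y hy0 hy t))
    apply sqrt_le_sqrt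
    nlinarith [sq_nonneg (sin t)]
  · apply one_div_lt_one_div_of_lt (sqrt_pos.2 (hpos y hy0 hy _))
    apply sqrt_lt_sqrt (hpos y hy0 hy _).le
    rw [sin_pi_div_two]; linarith

/-! ### Theta series -/

/-- theta three -/
noncomputable def th3 (s : ℝ) : ℝ := ∑' n : ℤ, exp (-π * s * (n : ℝ) ^ 2)

/-- theta four -/
noncomputable def th4 (s : ℝ) : ℝ := ∑' n : ℤ, (-1 : ℝ) ^ n * exp (-π * s * (n : ℝ) ^ 2)

/-- theta two -/
noncomputable def th2 (s : ℝ) : ℝ := th3 (s / 4) - th3 s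

lemma th3_summable {s : ℝ} (hs : 0 < s) :
    Summable (fun n : ℤ => exp (-π * s * (n : ℝ) ^ 2)) := by
  have h : Summable (fun n : ℕ => exp (-π * s * (n : ℝ) ^ 2)) := by
    have hg : Summable (fun n : ℕ => exp (-π * s) ^ n) := by
      apply summable_geometric_of_lt_one (exp_pos _).le
      rw [exp_lt_one_iff]
      nlinarith [mul_pos pi_pos hs]
    refine Summable.of_nonneg_of_le (fun n => (exp_pos _).le) (fun n => ?_) hg
    rw [← exp_nat_mul]
    apply exp_le_exp.2
    have h1 : (n : ℝ) ≤ (n : ℝ) ^ 2 := by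
      rcases Nat.eq_zero_or_pos n with h | h
      · simp [h]
      · have : (1 : ℝ) ≤ n := by exact_mod_cast h
        nlinarith
    nlinarith [mul_pos pi_pos hs]
  apply Summable.of_nat_of_neg
  · simpa using h
  · simpa using h

lemma neg_one_abs (n : ℤ) : |(-1 : ℝ) ^ n| = 1 := by
  rw [abs_zpow]; simp

lemma th4_summable {s : ℝ} (hs : 0 < s) :
    Summable (fun n : ℤ => (-1 : ℝ) ^ n * exp (-π * s * (n : ℝ) ^ 2)) := by
  apply Summable.of_norm
  simp only [norm_mul, norm_eq_abs, neg_one_abs, one_mul, abs_exp]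
  exact th3_summable hs

lemma th4_eq {s : ℝ} (hs : 0 < s) : th4 s = 2 * th3 (4 * s) - th3 s := by
  have h : th4 s + th3 s = 2 * th3 (4 * s) := by
    unfold th4 th3
    rw [← (th4_summable hs).tsum_add (th3_summable hs), ← tsum_mul_left]
    have hinj : Function.Injective (fun n : ℤ => 2 * n) := fun a b h => by
      simp only at h; omega
    rw [← hinj.tsum_eq]
    · apply tsum_congr
      intro n
      rw [Even.neg_one_zpow (even_two_mul n)]
      push_cast
      ring_nf
    · intro n hn
      by_contra hne
      apply hn
      have : Odd n := by
        rw [← Int.not_even_iff_odd]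
        rintro ⟨m, hm⟩
        exact hne ⟨m, by simp only; omega⟩
      simp [this.neg_one_zpow]
  linarith

lemma tsum_rot (F : ℤ × ℤ → ℝ) (hF : ∀ m n, Odd (m + n) → F (m, n) = 0) :
    ∑' z, F z = ∑' z : ℤ × ℤ, F (z.1 + z.2, z.1 - z.2) := by
  have hinj : Function.Injective (fun z : ℤ × ℤ => (z.1 + z.2, z.1 - z.2)) := by
    rintro ⟨a, b⟩ ⟨c, d⟩ h
    simp only [Prod.mk.injEq] at h ⊢
    omega
  rw [← hinj.tsum_eq]
  rintro ⟨m, n⟩ hn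
  by_contra hne
  apply hn
  apply hF
  rw [← Int.not_even_iff_odd]
  rintro ⟨u, hu⟩
  exact hne ⟨(u, m - u), by simp only [Prod.mk.injEq]; omega⟩

lemma tsum_prod' {f g : ℤ → ℝ} (hf : Summable f) (hg : Summable g) :
    (∑' n, f n) * ∑' n, g n = ∑' z : ℤ × ℤ, f z.1 * g z.2 :=
  tsum_mul_tsum_of_summable_norm hf.norm hg.norm

lemma summ_prod' {f g : ℤ → ℝ} (hf : Summable f) (hg : Summable g) :
    Summable (fun z : ℤ × ℤ => f z.1 * g z.2) :=
  summable_mul_of_summable_norm hf.norm hg.norm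

lemma gauss_rot (s : ℝ) (u v : ℤ) :
    exp (-π * s * ((u + v : ℤ) : ℝ) ^ 2) * exp (-π * s * ((u - v : ℤ) : ℝ) ^ 2) =
    exp (-π * (2 * s) * (u : ℝ) ^ 2) * exp (-π * (2 * s) * (v : ℝ) ^ 2) := by
  rw [← exp_add, ← exp_add]
  push_cast
  congr 1
  ring

lemma sgn_add (u v : ℤ) : (-1 : ℝ) ^ (u + v) = (-1) ^ u * (-1) ^ v :=
  zpow_add₀ (by norm_num) _ _

lemma sgn_sub (u v : ℤ) : (-1 : ℝ) ^ (u - v) = (-1) ^ u * (-1) ^ v := by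
  rw [zpow_sub₀ (by norm_num)]
  rcases Int.even_or_odd v with h | h
  · simp [h.neg_one_zpow]
  · simp [h.neg_one_zpow, div_neg]

lemma sgn_sq (u : ℤ) : (-1 : ℝ) ^ u * (-1) ^ u = 1 := by
  rcases Int.even_or_odd u with h | h
  · simp [h.neg_one_zpow]
  · simp [h.neg_one_zpow]

lemma th_sq {s : ℝ} (hs : 0 < s) : th3 s ^ 2 + th4 s ^ 2 = 2 * th3 (2 * s) ^ 2 := by
  have h3 := th3_summable hs
  have h4 := th4_summable hs
  have h32 := th3_summable (s := 2 * s) (by positivity)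
  unfold th3 th4
  rw [sq, sq, sq, tsum_prod' h3 h3, tsum_prod' h4 h4, tsum_prod' h32 h32,
    ← (summ_prod' h3 h3).tsum_add (summ_prod' h4 h4), ← tsum_mul_left, tsum_rot]
  · apply tsum_congr
    rintro ⟨u, v⟩
    simp only
    rw [sgn_add, sgn_sub]
    have e := gauss_rot s u v
    have e1 := sgn_sq u
    have e2 := sgn_sq v
    linear_combination (1 + ((-1 : ℝ) ^ u * (-1) ^ u) * ((-1) ^ v * (-1) ^ v)) * e +
      (exp (-π * (2 * s) * (u : ℝ) ^ 2) * exp (-π * (2 * s) * (v : ℝ) ^ 2)) *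
      (((-1 : ℝ) ^ v * (-1) ^ v) * e1 + e2)
  · intro m n h
    have := h.neg_one_zpow (α := ℝ)
    rw [sgn_add] at this
    simp only
    linear_combination exp (-π * s * (m : ℝ) ^ 2) * exp (-π * s * (n : ℝ) ^ 2) * this

lemma th_mul {s : ℝ} (hs : 0 < s) : th3 s * th4 s = th4 (2 * s) ^ 2 := by
  have h3 := th3_summable hs
  have h4 := th4_summable hs
  have h42 := th4_summable (s := 2 * s) (by positivity)
  have : th3 s * th4 s + th4 s * th3 s = 2 * th4 (2 * s) ^ 2 := by
    unfold th3 th4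
    rw [sq, tsum_prod' h3 h4, tsum_prod' h4 h3, tsum_prod' h42 h42,
      ← (summ_prod' h3 h4).tsum_add (summ_prod' h4 h3), ← tsum_mul_left, tsum_rot]
    · apply tsum_congr
      rintro ⟨u, v⟩
      simp only
      rw [sgn_add, sgn_sub]
      have e := gauss_rot s u v
      linear_combination 2 * ((-1 : ℝ) ^ u * (-1) ^ v) * e
    · intro m n h
      have := h.neg_one_zpow (α := ℝ)
      rw [sgn_add] at this
      have e1 := sgn_sq m
      have : (-1 : ℝ) ^ n = - (-1) ^ m := by
        linear_combination (-1) ^ m * this - (-1) ^ n * e1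
      simp only [this]
      ring
  linarith

lemma th3_inv {s : ℝ} (hs : 0 < s) : th3 (1 / s) = √s * th3 s := by
  have := Real.tsum_exp_neg_mul_int_sq hs
  unfold th3
  rw [this, ← sqrt_eq_rpow, ← mul_assoc, mul_one_div_cancel (sqrt_pos.2 hs).ne', one_mul]
  apply tsum_congr
  intro n
  congr 2
  ring

lemma th4_inv {s : ℝ} (hs : 0 < s) : th4 (1 / s) = √s * th2 s := by
  rw [th4_eq (by positivity), th3_inv hs, th2]
  have h := th3_inv (s := s / 4) (by positivity)
  have e : (4 * (1 / s)) = 1 / (s / 4) := by field_simp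
  rw [e, h, sqrt_div hs.le, show (4 : ℝ) = 2 ^ 2 by norm_num, sqrt_sq (by norm_num)]
  ring

lemma th3_inv_sq {s : ℝ} (hs : 0 < s) : th3 (1 / s) ^ 2 = s * th3 s ^ 2 := by
  rw [th3_inv hs, mul_pow, sq_sqrt hs.le]

lemma th4_inv_sq {s : ℝ} (hs : 0 < s) : th4 (1 / s) ^ 2 = s * th2 s ^ 2 := by
  rw [th4_inv hs, mul_pow, sq_sqrt hs.le]

lemma jacobi_quartic {s : ℝ} (hs : 0 < s) : th3 s ^ 4 = th2 s ^ 4 + th4 s ^ 4 := by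
  have h2 : 0 < 2 * s := by positivity
  have e : 2 * (1 / (2 * s)) = 1 / s := by field_simp
  have a1 := th_sq hs
  have a2 := th_sq (s := 1 / (2 * s)) (by positivity)
  have a3 := th_mul (s := 1 / (2 * s)) (by positivity)
  rw [e, th3_inv_sq h2, th4_inv_sq h2, th3_inv_sq hs] at a2
  rw [e, th3_inv h2, th4_inv h2, th4_inv_sq hs] at a3
  have a4 : √(2 * s) * √(2 * s) = 2 * s := mul_self_sqrt h2.le
  have b2 : th3 (2 * s) ^ 2 + th2 (2 * s) ^ 2 = th3 s ^ 2 := by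
    have : 2 * s * (th3 (2 * s) ^ 2 + th2 (2 * s) ^ 2) = 2 * s * th3 s ^ 2 := by linarith
    exact mul_left_cancel₀ h2.ne' this
  have b3 : 2 * (th3 (2 * s) * th2 (2 * s)) = th2 s ^ 2 := by
    have : s * (2 * (th3 (2 * s) * th2 (2 * s))) = s * th2 s ^ 2 := by
      linear_combination a3 - th3 (2 * s) * th2 (2 * s) * a4
    exact mul_left_cancel₀ hs.ne' this
  have c1 : th4 s ^ 2 = th3 (2 * s) ^ 2 - th2 (2 * s) ^ 2 := by linarith
  have : th3 s ^ 4 = (th3 s ^ 2) ^ 2 := by ring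
  rw [this, show th2 s ^ 4 = (th2 s ^ 2) ^ 2 by ring, show th4 s ^ 4 = (th4 s ^ 2) ^ 2 by ring,
    c1, ← b2, ← b3]
  ring

lemma th3_tendsto : Tendsto th3 atTop (𝓝 1) := by
  have h1 : (1 : ℝ) = ∑' n : ℤ, (if n = 0 then 1 else 0 : ℝ) := by simp
  rw [h1]
  refine tendsto_tsum_of_dominated_convergence (th3_summable one_pos) (fun n => ?_) ?_
  · split_ifs with h
    · simp [h]
    · apply tendsto_exp_atBot.comp
      have : (0 : ℝ) < (n : ℝ) ^ 2 := by
        have : (n : ℝ) ≠ 0 := by exact_mod_cast h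
        positivity
      apply Tendsto.atBot_mul_const this
      exact tendsto_id.const_mul_atTop_of_neg (by linarith [pi_pos])
  · filter_upwards [eventually_ge_atTop 1] with s hs n
    rw [norm_eq_abs, abs_exp]
    apply exp_le_exp.2
    have := pi_pos
    have h2 : π * 1 * (n : ℝ) ^ 2 ≤ π * s * (n : ℝ) ^ 2 := by gcongr
    linarith

lemma th3_pos {s : ℝ} (hs : 0 < s) : 0 < th3 s :=
  (th3_summable hs).tsum_pos (fun _ => (exp_pos _).le) 0 (exp_pos _)

lemma th4_tendsto : Tendsto th4 atTop (𝓝 1) := by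
  have h : Tendsto (fun s => 2 * th3 (4 * s) - th3 s) atTop (𝓝 (2 * 1 - 1)) :=
    ((th3_tendsto.comp (tendsto_id.const_mul_atTop (by norm_num))).const_mul 2).sub th3_tendsto
  norm_num at h
  refine h.congr' ?_
  filter_upwards [eventually_gt_atTop 0] with s hs
  exact (th4_eq hs).symm


/-! ### Gauss's product -/

/-- partial products -/
noncomputable def qP (q : ℝ) (n : ℕ) : ℝ := ∏ i ∈ Finset.range n, (1 - q ^ (i + 1))

/-- partial products -/
noncomputable def qM (q : ℝ) (n : ℕ) : ℝ := ∏ i ∈ Finset.range n, (1 + q ^ (i + 1))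

/-- reciprocal of the q-factorial, extended by zero -/
noncomputable def qg (q : ℝ) (k : ℤ) : ℝ := if k < 0 then 0 else 1 / qP q k.toNat

section
variable {q : ℝ}

lemma qpow_lt (h0 : 0 < q) (h1 : q < 1) (i : ℕ) : q ^ (i + 1) < 1 :=
  pow_lt_one₀ h0.le h1 (by omega)

lemma qP_pos (h0 : 0 < q) (h1 : q < 1) (n : ℕ) : 0 < qP q n :=
  Finset.prod_pos (fun i _ => by linarith [qpow_lt h0 h1 i])

lemma qM_pos (h0 : 0 < q) (n : ℕ) : 0 < qM q n :=
  Finset.prod_pos (fun i _ => by positivity)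

lemma qg_neg {k : ℤ} (hk : k < 0) : qg q k = 0 := by simp [qg, hk]

lemma qg_nat (n : ℕ) : qg q n = 1 / qP q n := by simp [qg]

lemma qg_nonneg (h0 : 0 < q) (h1 : q < 1) (k : ℤ) : 0 ≤ qg q k := by
  unfold qg
  split_ifs
  · exact le_rfl
  · exact (one_div_pos.2 (qP_pos h0 h1 _)).le

lemma qg_rec (h0 : 0 < q) (h1 : q < 1) (k : ℤ) : qg q (k - 1) = (1 - q ^ k) * qg q k := by
  rcases lt_trichotomy k 0 with h | h | h
  · rw [qg_neg h, qg_neg (by omega)]; simp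
  · subst h; rw [qg_neg (by omega)]; simp
  · obtain ⟨n, rfl⟩ : ∃ n : ℕ, k = (n + 1 : ℕ) := ⟨(k - 1).toNat, by omega⟩
    have e : ((n + 1 : ℕ) : ℤ) - 1 = (n : ℤ) := by push_cast; ring
    rw [e, qg_nat, qg_nat, zpow_natCast, qP, qP, Finset.prod_range_succ]
    have a := qpow_lt h0 h1 n
    have b := (qP_pos h0 h1 n).ne'
    unfold qP at b
    have c : 1 - q ^ (n + 1) ≠ 0 := by linarith
    field_simp

/-- summand -/
noncomputable def qF (q : ℝ) (n : ℕ) (j : ℤ) : ℝ :=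
  (-1 : ℝ) ^ j * q ^ (j ^ 2) * qg q (n - j) * qg q (n + j)

lemma qF_summable (n : ℕ) : Summable (qF q n) := by
  apply summable_of_ne_finset_zero (s := Finset.Icc (-(n : ℤ)) n)
  intro j hj
  rw [Finset.mem_Icc, not_and_or] at hj
  unfold qF
  rcases hj with h | h
  · rw [qg_neg (k := n + j) (by omega)]; simp
  · rw [qg_neg (k := n - j) (by omega)]; simp

lemma summable_shift {f : ℤ → ℝ} (hf : Summable f) : Summable (fun j => f (j + 1)) :=
  hf.comp_injective (add_left_injective (1 : ℤ))

lemma tsum_shift (f : ℤ → ℝ) : ∑' j, f (j + 1) = ∑' j, f j :=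
  (Equiv.addRight (1 : ℤ)).tsum_eq f

lemma qF_sum (h0 : 0 < q) (h1 : q < 1) (n : ℕ) : qP q n * qM q n * ∑' j, qF q n j = 1 := by
  induction n with
  | zero =>
    rw [tsum_eq_single 0]
    · simp [qF, qP, qM, qg]
    · intro j hj
      unfold qF
      rcases lt_or_gt_of_ne hj with h | h
      · rw [qg_neg (k := ((0 : ℕ) : ℤ) + j) (by push_cast; omega)]; simp
      · rw [qg_neg (k := ((0 : ℕ) : ℤ) - j) (by push_cast; omega)]; simp
  | succ n ih =>
    rw [← ih]
    rw [← sub_eq_zero, ← tsum_mul_left, ← tsum_mul_left,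
      ← ((qF_summable _).mul_left _).tsum_sub ((qF_summable _).mul_left _)]
    set N : ℤ := (n : ℤ) + 1 with hN
    set H : ℤ → ℝ := fun j => (-1 : ℝ) ^ j * q ^ (j ^ 2 - j + N) * qg q (N - j) * qg q (N + j - 1)
      with hH
    have hHs : Summable H := by
      apply summable_of_ne_finset_zero (s := Finset.Icc (-N) N)
      intro j hj
      rw [Finset.mem_Icc, not_and_or] at hj
      simp only [hH]
      rcases hj with h | h
      · rw [qg_neg (k := N + j - 1) (by omega)]; simp
      · rw [qg_neg (k := N - j) (by omega)]; simp
    have hHs' : Summable (fun j => H (j + 1)) := summable_shift hHs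
    have hsh : ∑' j, H (j + 1) = ∑' j, H j := tsum_shift H
    have hterm : ∀ j, qP q (n + 1) * qM q (n + 1) * qF q (n + 1) j - qP q n * qM q n * qF q n j
        = qP q n * qM q n * (H j - H (j + 1)) := by
      intro j
      have e1 : qg q (n - j) = (1 - q ^ (N - j)) * qg q (N - j) := by
        rw [← qg_rec h0 h1]; congr 1; omega
      have e2 : qg q (n + j) = (1 - q ^ (N + j)) * qg q (N + j) := by
        rw [← qg_rec h0 h1]; congr 1; omega
      have e3 : qg q (N + j - 1) = (1 - q ^ (N + j)) * qg q (N + j) := qg_rec h0 h1 _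
      have e4 : qg q (N - (j + 1)) = (1 - q ^ (N - j)) * qg q (N - j) := by
        rw [← qg_rec h0 h1]; congr 1; omega
      have e5 : N + (j + 1) - 1 = N + j := by ring
      have e6 : qP q (n + 1) * qM q (n + 1) = qP q n * qM q n * (1 - q ^ (N - j) * q ^ (N + j)) := by
        rw [← zpow_add₀ h0.ne']
        have : N - j + (N + j) = ((n + 1 + (n + 1) : ℕ) : ℤ) := by push_cast; omega
        rw [this, zpow_natCast, qP, qM, Finset.prod_range_succ, Finset.prod_range_succ, qP, qM,
          pow_add]
        ring
      have e7 : q ^ (j ^ 2 - j + N) = q ^ (j ^ 2) * q ^ (N - j) := by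
        rw [← zpow_add₀ h0.ne']; congr 1; ring
      have e8 : q ^ ((j + 1) ^ 2 - (j + 1) + N) = q ^ (j ^ 2) * q ^ (N + j) := by
        rw [← zpow_add₀ h0.ne']; congr 1; ring
      have e9 : (-1 : ℝ) ^ (j + 1) = - (-1) ^ j := by
        rw [zpow_add₀ (by norm_num)]; simp
      simp only [hH, qF]
      rw [e1, e2, e3, e4, e5, e6, e7, e8, e9]
      have e10 : ((n + 1 : ℕ) : ℤ) = N := by push_cast; rfl
      rw [e10]
      ring
    simp_rw [hterm]
    rw [tsum_mul_left, hHs.tsum_sub hHs', hsh]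
    ring

/-- the series in the statement -/
noncomputable def qS (q : ℝ) (ν : ℕ) : ℝ :=
  ∑' n : ℕ, q ^ (ν * (2 * n + 1)) / ((2 * n + 1 : ℝ) * (1 - q ^ (2 * n + 1)))

lemma qS_term (h0 : 0 < q) (h1 : q < 1) {ν : ℕ} (hν : 1 ≤ ν) (n : ℕ) :
    0 ≤ q ^ (ν * (2 * n + 1)) / ((2 * n + 1 : ℝ) * (1 - q ^ (2 * n + 1))) ∧
    q ^ (ν * (2 * n + 1)) / ((2 * n + 1 : ℝ) * (1 - q ^ (2 * n + 1))) ≤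
      q ^ ν / (1 - q) * (q ^ 2) ^ n := by
  have a := qpow_lt h0 h1 (2 * n)
  have a' : q ^ (2 * n + 1) ≤ q := by
    rw [pow_succ]
    have := pow_le_one₀ h0.le h1.le (n := 2 * n)
    nlinarith
  have b : (0 : ℝ) < 1 - q ^ (2 * n + 1) := by linarith
  have c : (1 : ℝ) - q ≤ (2 * n + 1 : ℝ) * (1 - q ^ (2 * n + 1)) := by
    have : (1 : ℝ) ≤ 2 * n + 1 := by
      have : (0 : ℝ) ≤ n := Nat.cast_nonneg n
      linarith
    nlinarith
  refine ⟨by positivity, ?_⟩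
  rw [div_mul_eq_mul_div, ← pow_mul, ← pow_add]
  apply div_le_div₀ (by positivity) _ (by linarith) c
  apply pow_le_pow_of_le_one h0.le h1.le
  nlinarith

lemma qS_bd_summable (h0 : 0 < q) (h1 : q < 1) (ν : ℕ) :
    Summable (fun n : ℕ => q ^ ν / (1 - q) * (q ^ 2) ^ n) :=
  (summable_geometric_of_lt_one (by positivity) (by nlinarith)).mul_left _

lemma qS_summable (h0 : 0 < q) (h1 : q < 1) {ν : ℕ} (hν : 1 ≤ ν) :
    Summable (fun n : ℕ => q ^ (ν * (2 * n + 1)) / ((2 * n + 1 : ℝ) * (1 - q ^ (2 * n + 1)))) :=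
  Summable.of_nonneg_of_le (fun n => (qS_term h0 h1 hν n).1) (fun n => (qS_term h0 h1 hν n).2)
    (qS_bd_summable h0 h1 ν)

lemma qS_nonneg (h0 : 0 < q) (h1 : q < 1) {ν : ℕ} (hν : 1 ≤ ν) : 0 ≤ qS q ν :=
  tsum_nonneg (fun n => (qS_term h0 h1 hν n).1)

lemma qS_le (h0 : 0 < q) (h1 : q < 1) {ν : ℕ} (hν : 1 ≤ ν) :
    qS q ν ≤ q ^ ν / (1 - q) * (1 - q ^ 2)⁻¹ := by
  rw [← tsum_geometric_of_lt_one (by positivity) (show q ^ 2 < 1 by nlinarith), ← tsum_mul_left]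
  exact (qS_summable h0 h1 hν).tsum_le_tsum (fun n => (qS_term h0 h1 hν n).2)
    (qS_bd_summable h0 h1 ν)

lemma qS_step (h0 : 0 < q) (h1 : q < 1) {ν : ℕ} (hν : 1 ≤ ν) :
    qS q ν = arctanh (q ^ ν) + qS q (ν + 1) := by
  have hx : q ^ ν < 1 := pow_lt_one₀ h0.le h1 (by omega)
  have hx0 : 0 < q ^ ν := by positivity
  have hs := hasSum_log_sub_log_of_abs_lt_one (x := q ^ ν) (by rw [abs_of_pos hx0]; exact hx)
  rw [← log_div (by linarith) (by linarith)] at hs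
  have hs2 := hs.div_const 2
  rw [← sub_eq_iff_eq_add, arctanh, ← hs2.tsum_eq, qS, qS,
    ← (qS_summable h0 h1 hν).tsum_sub (qS_summable h0 h1 (by omega))]
  apply tsum_congr
  intro n
  have a := qpow_lt h0 h1 (2 * n)
  have b : (1 : ℝ) - q ^ (2 * n + 1) ≠ 0 := by linarith
  have c : (2 * n + 1 : ℝ) ≠ 0 := by positivity
  have e : q ^ ((ν + 1) * (2 * n + 1)) = q ^ (ν * (2 * n + 1)) * q ^ (2 * n + 1) := by
    rw [← pow_add]; ring_nf
  rw [e, ← pow_mul]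
  field_simp

lemma qS_sum (h0 : 0 < q) (h1 : q < 1) (n : ℕ) :
    qS q 1 = ∑ j ∈ Finset.range n, arctanh (q ^ (j + 1)) + qS q (n + 1) := by
  induction n with
  | zero => simp
  | succ n ih => rw [ih, Finset.sum_range_succ, qS_step h0 h1 (ν := n + 1) (by omega)]; ring

lemma sum_arctanh (h0 : 0 < q) (h1 : q < 1) (n : ℕ) :
    ∑ j ∈ Finset.range n, arctanh (q ^ (j + 1)) = - log (qP q n / qM q n) / 2 := by
  induction n with
  | zero => simp [qP, qM]
  | succ n ih =>
    rw [Finset.sum_range_succ, ih, log_div (qP_pos h0 h1 _).ne' (qM_pos h0 _).ne',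
      log_div (qP_pos h0 h1 _).ne' (qM_pos h0 _).ne']
    have a := qpow_lt h0 h1 n
    have b : 0 < q ^ (n + 1) := by positivity
    have e1 : qP q (n + 1) = qP q n * (1 - q ^ (n + 1)) := Finset.prod_range_succ _ _
    have e2 : qM q (n + 1) = qM q n * (1 + q ^ (n + 1)) := Finset.prod_range_succ _ _
    rw [e1, e2, log_mul (qP_pos h0 h1 _).ne' (by linarith),
      log_mul (qM_pos h0 _).ne' (by linarith), arctanh, log_div (by linarith) (by linarith)]
    ring

lemma ratio_tendsto (h0 : 0 < q) (h1 : q < 1) :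
    Tendsto (fun n => qP q n / qM q n) atTop (𝓝 (exp (-2 * qS q 1))) := by
  have hz : Tendsto (fun n => qS q (n + 1)) atTop (𝓝 0) := by
    have h : Tendsto (fun n : ℕ => q ^ (n + 1) / (1 - q) * (1 - q ^ 2)⁻¹) atTop (𝓝 0) := by
      have := (((tendsto_pow_atTop_nhds_zero_of_lt_one h0.le h1).comp
        (tendsto_add_atTop_nat 1)).div_const (1 - q)).mul_const ((1 - q ^ 2)⁻¹)
      simpa using this
    exact squeeze_zero (fun n => qS_nonneg h0 h1 (by omega)) (fun n => qS_le h0 h1 (by omega)) h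
  have h2 : Tendsto (fun n => exp (-2 * (qS q 1 - qS q (n + 1)))) atTop
      (𝓝 (exp (-2 * (qS q 1 - 0)))) :=
    (continuous_exp.tendsto _).comp ((tendsto_const_nhds.sub hz).const_mul (-2))
  rw [sub_zero] at h2
  refine h2.congr (fun n => ?_)
  rw [qS_sum h0 h1 n, sum_arctanh h0 h1, add_sub_cancel_right]
  rw [show -2 * (-log (qP q n / qM q n) / 2) = log (qP q n / qM q n) by ring, exp_log]
  exact div_pos (qP_pos h0 h1 _) (qM_pos h0 _)

lemma qg_bd (h0 : 0 < q) (h1 : q < 1) (k : ℤ) : qg q k ≤ exp (2 * qS q 1) := by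
  unfold qg
  split_ifs
  · exact (exp_pos _).le
  · set n := k.toNat
    have hM : 1 ≤ qM q n := Finset.one_le_prod (fun i _ => by linarith [pow_pos h0 (i + 1)])
    have hP := qP_pos h0 h1 n
    have hge : exp (-2 * qS q 1) ≤ qP q n / qM q n := by
      rw [← exp_log (div_pos hP (qM_pos h0 n))]
      apply exp_le_exp.2
      have := qS_sum h0 h1 n
      rw [sum_arctanh h0 h1] at this
      linarith [qS_nonneg h0 h1 (show 1 ≤ n + 1 by omega)]
    have : exp (-2 * qS q 1) ≤ qP q n := hge.trans (div_le_self hP.le hM)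
    rw [one_div, show 2 * qS q 1 = -(-2 * qS q 1) by ring, exp_neg]
    exact inv_anti₀ (exp_pos _) this

lemma qg_tendsto (h0 : 0 < q) (h1 : q < 1) :
    ∃ G, 0 < G ∧ Tendsto (fun n : ℕ => qg q n) atTop (𝓝 G) := by
  have hmono : Monotone (fun n : ℕ => qg q n) := by
    apply monotone_nat_of_le_succ
    intro n
    have := qg_rec h0 h1 ((n + 1 : ℕ) : ℤ)
    rw [show ((n + 1 : ℕ) : ℤ) - 1 = n by push_cast; ring] at this
    rw [this, zpow_natCast]
    have a := pow_pos h0 (n + 1)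
    nlinarith [qg_nonneg h0 h1 ((n + 1 : ℕ) : ℤ)]
  have hbd : BddAbove (Set.range (fun n : ℕ => qg q n)) :=
    ⟨_, by rintro _ ⟨n, rfl⟩; exact qg_bd h0 h1 n⟩
  refine ⟨_, ?_, tendsto_atTop_ciSup hmono hbd⟩
  refine lt_of_lt_of_le ?_ (le_ciSup hbd 0)
  simp [qg, qP]

lemma gauss_product {s : ℝ} (hs : 0 < s) (hq : q = exp (-π * s)) :
    th4 s = exp (-2 * qS q 1) := by
  have h0 : 0 < q := by rw [hq]; exact exp_pos _
  have h1 : q < 1 := by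
    rw [hq, exp_lt_one_iff]; nlinarith [mul_pos pi_pos hs]
  obtain ⟨G, hG, hGt⟩ := qg_tendsto h0 h1
  have hpow : ∀ j : ℤ, q ^ (j ^ 2) = exp (-π * s * (j : ℝ) ^ 2) := by
    intro j
    rw [hq, ← rpow_intCast, ← exp_mul]
    push_cast
    rfl
  have hZ : Tendsto (qg q) atTop (𝓝 G) := by
    rw [← Nat.map_cast_int_atTop]
    exact hGt
  have hlim : Tendsto (fun n : ℕ => ∑' j, qF q n j) atTop
      (𝓝 (∑' j : ℤ, (-1 : ℝ) ^ j * exp (-π * s * (j : ℝ) ^ 2) * G * G)) := by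
    refine tendsto_tsum_of_dominated_convergence
      (bound := fun j : ℤ => exp (-π * s * (j : ℝ) ^ 2) * exp (2 * qS q 1) * exp (2 * qS q 1))
      (((th3_summable hs).mul_right _).mul_right _) (fun j => ?_) ?_
    · have a1 : Tendsto (fun n : ℕ => qg q (n - j)) atTop (𝓝 G) :=
        hZ.comp (tendsto_atTop_add_const_right _ (-j) tendsto_natCast_atTop_atTop)
      have a2 : Tendsto (fun n : ℕ => qg q (n + j)) atTop (𝓝 G) :=
        hZ.comp (tendsto_atTop_add_const_right _ j tendsto_natCast_atTop_atTop)
      rw [← hpow]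
      exact (a1.const_mul _).mul a2
    · filter_upwards with n j
      rw [qF, hpow, norm_mul, norm_mul, norm_mul, norm_eq_abs, neg_one_abs, one_mul,
        norm_eq_abs, abs_exp, norm_eq_abs, abs_of_nonneg (qg_nonneg h0 h1 _), norm_eq_abs,
        abs_of_nonneg (qg_nonneg h0 h1 _)]
      have b1 := qg_bd h0 h1 (n - j)
      have b2 := qg_bd h0 h1 (n + j)
      have b3 := qg_nonneg h0 h1 (n + j)
      have b4 := qg_nonneg h0 h1 (n - j)
      gcongr
  rw [tsum_mul_right, tsum_mul_right] at hlim
  have hlim2 : Tendsto (fun n : ℕ => qP q n / qM q n * (qg q n * qg q n)) atTop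
      (𝓝 (exp (-2 * qS q 1) * (G * G))) := (ratio_tendsto h0 h1).mul (hGt.mul hGt)
  have heq : ∀ n : ℕ, ∑' j, qF q n j = qP q n / qM q n * (qg q n * qg q n) := by
    intro n
    have a := qF_sum h0 h1 n
    have b := (qP_pos h0 h1 n).ne'
    have c := (qM_pos h0 n).ne'
    rw [qg_nat]
    have : ∑' j, qF q n j = 1 / (qP q n * qM q n) := by
      rw [eq_div_iff (mul_ne_zero b c), mul_comm]; exact a
    rw [this]
    field_simp
  have hu := tendsto_nhds_unique (hlim.congr heq) hlim2
  unfold th4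
  have hGG : G * G ≠ 0 := by positivity
  apply mul_right_cancel₀ hGG
  linarith

end

lemma th4_pos {s : ℝ} (hs : 0 < s) : 0 < th4 s := by
  rw [gauss_product hs rfl]; exact exp_pos _

lemma EI_theta {s : ℝ} (hs : 0 < s) : EI (th3 s ^ 2) (th4 s ^ 2) = π / 2 := by
  have step : ∀ s, 0 < s → EI (th3 (2 * s) ^ 2) (th4 (2 * s) ^ 2) = EI (th3 s ^ 2) (th4 s ^ 2) := by
    intro s hs
    have a := th3_pos hs
    have b := th4_pos hs
    have c := th4_pos (s := 2 * s) (by positivity)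
    rw [← EI_landen (a := th3 s ^ 2) (b := th4 s ^ 2) (c := th4 (2 * s) ^ 2) (by positivity)
      (by positivity) (by positivity) (by rw [← th_mul hs]; ring), th_sq hs]
    congr 1
    ring
  have hn : ∀ n : ℕ, EI (th3 (2 ^ n * s) ^ 2) (th4 (2 ^ n * s) ^ 2) = EI (th3 s ^ 2) (th4 s ^ 2) := by
    intro n
    induction n with
    | zero => simp
    | succ n ih =>
      rw [← ih, ← step (2 ^ n * s) (by positivity), pow_succ' 2 n, mul_assoc]
  have ht : Tendsto (fun n : ℕ => 2 ^ n * s) atTop atTop :=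
    (tendsto_pow_atTop_atTop_of_one_lt (by norm_num : (1 : ℝ) < 2)).atTop_mul_const hs
  have h3 := (th3_tendsto.comp ht).pow 2
  have h4 := (th4_tendsto.comp ht).pow 2
  rw [one_pow] at h3 h4
  have := EI_tendsto h3 h4
  simp only [Function.comp, hn] at this
  exact tendsto_nhds_unique tendsto_const_nhds this

lemma kint_theta {s : ℝ} (hs : 0 < s) : ∃ k₀ : ℝ, 0 < k₀ ∧ k₀ < 1 ∧
    √(1 - k₀ ^ 2) = th4 s ^ 2 / th3 s ^ 2 ∧ Kint k₀ = π / 2 * th3 s ^ 2 ∧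
    Kint (√(1 - k₀ ^ 2)) = s * Kint k₀ := by
  have p3 := th3_pos hs
  have p4 := th4_pos hs
  have p2 : 0 < th2 s := by
    have := th4_pos (s := 1 / s) (by positivity)
    rw [th4_inv hs] at this
    exact pos_of_mul_pos_right this (sqrt_nonneg _)
  have hj := jacobi_quartic hs
  have e1 : 1 - (th2 s ^ 2 / th3 s ^ 2) ^ 2 = (th4 s ^ 2 / th3 s ^ 2) ^ 2 := by
    field_simp
    linarith
  have e2 : 1 - (th4 s ^ 2 / th3 s ^ 2) ^ 2 = (th2 s ^ 2 / th3 s ^ 2) ^ 2 := by linarith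
  have e3 : √(1 - (th2 s ^ 2 / th3 s ^ 2) ^ 2) = th4 s ^ 2 / th3 s ^ 2 := by
    rw [e1, sqrt_sq (by positivity)]
  have e4 : √(1 - (th4 s ^ 2 / th3 s ^ 2) ^ 2) = th2 s ^ 2 / th3 s ^ 2 := by
    rw [e2, sqrt_sq (by positivity)]
  have k0 : 0 < th2 s ^ 2 / th3 s ^ 2 := by positivity
  have k0' : 0 < th4 s ^ 2 / th3 s ^ 2 := by positivity
  have k1 : th2 s ^ 2 / th3 s ^ 2 < 1 := by nlinarith [pow_pos k0' 2]
  have k1' : th4 s ^ 2 / th3 s ^ 2 < 1 := by nlinarith [pow_pos k0 2]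
  have hK : Kint (th2 s ^ 2 / th3 s ^ 2) = π / 2 * th3 s ^ 2 := by
    rw [Kint_eq_EI k0.le k1.le, e3, ← EI_theta hs]
    have := EI_scale (a := 1) (b := th4 s ^ 2 / th3 s ^ 2) (c := th3 s ^ 2) (by positivity)
    rw [mul_one, mul_div_cancel₀ _ (by positivity)] at this
    rw [this]; field_simp
  refine ⟨th2 s ^ 2 / th3 s ^ 2, k0, k1, e3, hK, ?_⟩
  rw [hK, e3, Kint_eq_EI k0'.le k1'.le, e4]
  have h1 := EI_theta (s := 1 / s) (by positivity)
  rw [th3_inv_sq hs, th4_inv_sq hs] at h1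
  have := EI_scale (a := 1) (b := th2 s ^ 2 / th3 s ^ 2) (c := s * th3 s ^ 2) (by positivity)
  rw [mul_one, mul_assoc, mul_div_cancel₀ _ (by positivity), h1] at this
  rw [this]; field_simp

theorem k_unique {s k k₀ : ℝ} (hs : 0 < s) (h0 : 0 < k) (h1 : k < 1) (h0' : 0 < k₀) (h1' : k₀ < 1)
    (hk : Kint (√(1 - k ^ 2)) = s * Kint k) (hk' : Kint (√(1 - k₀ ^ 2)) = s * Kint k₀) :
    k = k₀ := by
  have aux : ∀ x y : ℝ, 0 < x → x < y → y < 1 → Kint (√(1 - x ^ 2)) = s * Kint x →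
      Kint (√(1 - y ^ 2)) = s * Kint y → False := by
    intro x y hx hxy hy ex ey
    have a := Kint_lt hx.le hxy hy
    have b : √(1 - y ^ 2) < √(1 - x ^ 2) := sqrt_lt_sqrt (by nlinarith) (by nlinarith)
    have c : √(1 - x ^ 2) < 1 := by
      rw [sqrt_lt' one_pos]; nlinarith
    have d := Kint_lt (sqrt_nonneg _) b c
    rw [ex, ey] at d
    nlinarith
  rcases lt_trichotomy k k₀ with h | h | h
  · exact (aux _ _ h0 h h1' hk hk').elim
  · exact h
  · exact (aux _ _ h0' h h1 hk' hk).elim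

/-- `4 ∑_{n=0}^∞ q^{ν(2n+1)}/((2n+1)(1-q^{2n+1})) =
-4 ∑_{j=1}^{ν-1} arctanh(qʲ) - log(2 k'_r K(k_r)/π)` with `q = e^{-π√r}`. -/
theorem stmt_11 (r : ℝ) (hr : 0 < r) (q : ℝ) (hq : q = Real.exp (-Real.pi * Real.sqrt r))
    (k : ℝ) (hk0 : 0 < k) (hk1 : k < 1)
    (hK : Kint (Real.sqrt (1 - k ^ 2)) = Real.sqrt r * Kint k)
    (ν : ℕ) (hν : 1 ≤ ν) :
    4 * ∑' n : ℕ, q ^ (ν * (2 * n + 1)) / ((2 * n + 1 : ℝ) * (1 - q ^ (2 * n + 1))) =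
      -4 * (∑ j ∈ Finset.range (ν - 1), arctanh (q ^ (j + 1))) -
        Real.log (2 * Real.sqrt (1 - k ^ 2) * Kint k / Real.pi) := by
  have hs : 0 < Real.sqrt r := Real.sqrt_pos.2 hr
  obtain ⟨k₀, a0, a1, e1, e2, e3⟩ := kint_theta hs
  have hkk : k = k₀ := k_unique hs hk0 hk1 a0 a1 hK e3
  have h0 : 0 < q := by rw [hq]; exact Real.exp_pos _
  have h1 : q < 1 := by
    rw [hq, Real.exp_lt_one_iff]; nlinarith [mul_pos Real.pi_pos hs]
  have p3 := th3_pos hs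
  have hval : 2 * Real.sqrt (1 - k ^ 2) * Kint k / Real.pi = th4 (Real.sqrt r) ^ 2 := by
    rw [hkk, e1, e2]
    have := Real.pi_pos
    field_simp
  rw [hval, gauss_product hs hq, Real.log_pow, Real.log_exp]
  have hS := qS_sum h0 h1 (ν - 1)
  rw [Nat.sub_add_cancel hν] at hS
  change 4 * qS q ν = _
  push_cast
  linarith
end
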